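/- arXiv:2603.27774 — 3 statements merged into one kernel-verified Lean document; each statement's English description precedes it below -/
import Mathlib

section
/- For every real ε > 0 there exists N such that for every n ≥ N and every 2-CNF formula φ with at most n variables, there exists a 2-CNF formula φ' such that φ ⊢* φ' and |φ'| ≤ (1 + ε) · n² / log₂ n. -/
namespace BVAPaper

/-- A literal is a propositional variable (a natural number) together with a
polarity: `true` for a positive literal, `false` for a negative one. -/
abbrev Lit := ℕ × Bool

/-- A clause is a finite set of literals (required to be pairwise
non-complementary via `IsClause`). -/
abbrev Clause := Finset Lit

/-- A formula is a finite set of clauses; its size is its number of clauses. -/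
abbrev Formula := Finset Clause

/-- A genuine clause: it contains no pair of complementary literals. -/
def IsClause (C : Clause) : Prop := ∀ v : ℕ, ¬ ((v, true) ∈ C ∧ (v, false) ∈ C)

/-- A 2-CNF formula: every member is a genuine clause with exactly two literals. -/
def Is2CNF (φ : Formula) : Prop := ∀ C ∈ φ, IsClause C ∧ C.card = 2

/-- The set of variables occurring in a formula. -/
def Vars (φ : Formula) : Finset ℕ := φ.biUnion (fun C => C.image Prod.fst)

/-- A literal is true under an assignment. -/
def LitTrue (τ : ℕ → Bool) (l : Lit) : Prop := τ l.1 = l.2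

/-- An assignment satisfies a formula if it makes some literal of every clause true. -/
def Satisfies (τ : ℕ → Bool) (φ : Formula) : Prop := ∀ C ∈ φ, ∃ l ∈ C, LitTrue τ l

/-- `φ` semantically implies the equivalence of the literals `l₁` and `l₂`. -/
def ImpliesEquiv (φ : Formula) (l₁ l₂ : Lit) : Prop :=
  ∀ τ : ℕ → Bool, Satisfies τ φ → (LitTrue τ l₁ ↔ LitTrue τ l₂)

/-- A simple 2-CNF formula: (a) no two distinct literals are implied equivalent,
(b) every clause contains a negative literal, (c) no two distinct clauses are over
the same pair of variables. -/
def IsSimple (φ : Formula) : Prop :=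
  (∀ l₁ l₂ : Lit, l₁ ≠ l₂ → ¬ ImpliesEquiv φ l₁ l₂) ∧
  (∀ C ∈ φ, ∃ l ∈ C, l.2 = false) ∧
  (∀ C₁ ∈ φ, ∀ C₂ ∈ φ, C₁.image Prod.fst = C₂.image Prod.fst → C₁ = C₂)

/-- A monotone formula: every literal occurring in it is positive. -/
def MonotoneFormula (φ : Formula) : Prop := ∀ C ∈ φ, ∀ l ∈ C, l.2 = true

/-- `𝒞 ⋈ 𝒟`: the set of clauses `C ∪ D` for `C ∈ 𝒞` and `D ∈ 𝒟`. -/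
def JoinClauses (𝒞 𝒟 : Finset Clause) : Finset Clause :=
  (𝒞 ×ˢ 𝒟).image (fun p => p.1 ∪ p.2)

/-- One BVA step. -/
def BVAStep (φ φ' : Formula) : Prop :=
  ∃ (𝒞 𝒟 : Finset Clause) (y : ℕ),
    (∀ C ∈ 𝒞, IsClause C ∧ C.Nonempty) ∧
    (∀ D ∈ 𝒟, IsClause D ∧ D.Nonempty) ∧
    JoinClauses 𝒞 𝒟 ⊆ φ ∧
    y ∉ Vars φ ∧
    φ' = (φ \ JoinClauses 𝒞 𝒟)
      ∪ 𝒞.image (fun C => insert ((y, true) : Lit) C)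
      ∪ 𝒟.image (fun D => insert ((y, false) : Lit) D)

/-- Idealized BVA: the reflexive transitive closure of single BVA steps. -/
def BVAChain : Formula → Formula → Prop := Relation.ReflTransGen BVAStep

/-- Negate the variables from `S` inside a literal. -/
def flipLit (S : Finset ℕ) (l : Lit) : Lit := if l.1 ∈ S then (l.1, !l.2) else l

/-- Negate the variables from `S` throughout a formula. -/
def flipFormula (S : Finset ℕ) (φ : Formula) : Formula :=
  φ.image (fun C => C.image (flipLit S))

/-- `φ ≅_W φ'`: `φ'` is obtained from `φ` by replacing some variables from `W`
by their negations wherever they appear. -/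
def EquivW (W : Finset ℕ) (φ φ' : Formula) : Prop :=
  ∃ S ⊆ W, φ' = flipFormula S φ

/-- `φ'` encodes `φ` over the base variables `X`: for every assignment `τ` of `X`,
`τ` satisfies `φ` iff `τ` extends to a satisfying assignment of `φ'`. -/
def Encodes (φ' φ : Formula) (X : Finset ℕ) : Prop :=
  ∀ τ : ℕ → Bool,
    Satisfies τ φ ↔ ∃ σ : ℕ → Bool, (∀ x ∈ X, σ x = τ x) ∧ Satisfies σ φ'

/-- The direct encoding of the at-most-one constraint on the variables `0, …, n-1`. -/
def atMostOne (n : ℕ) : Formula :=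
  (((Finset.range n) ×ˢ (Finset.range n)).filter (fun p => p.1 < p.2)).image
    (fun p => ({(p.1, false), (p.2, false)} : Clause))

/-- A diagram: a graph with both undirected edges (represented as a symmetric
set of ordered pairs) and directed edges. -/
structure Diagram where
  verts : Finset ℕ
  undir : Finset (ℕ × ℕ)
  dir : Finset (ℕ × ℕ)

/-- Well-formedness of a diagram: no loops, edges between vertices, the
undirected edge set is symmetric, and at most one edge between any two vertices. -/
def Diagram.WF (G : Diagram) : Prop :=
  (∀ e ∈ G.undir, e.1 ∈ G.verts ∧ e.2 ∈ G.verts ∧ e.1 ≠ e.2) ∧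
  (∀ e ∈ G.dir, e.1 ∈ G.verts ∧ e.2 ∈ G.verts ∧ e.1 ≠ e.2) ∧
  (∀ u v : ℕ, (u, v) ∈ G.undir → (v, u) ∈ G.undir) ∧
  (∀ u v : ℕ, (u, v) ∈ G.undir → (u, v) ∉ G.dir ∧ (v, u) ∉ G.dir) ∧
  (∀ u v : ℕ, (u, v) ∈ G.dir → (v, u) ∉ G.dir)

/-- The complete diagram `K_n` on vertices `0, …, n-1`: all edges undirected. -/
def completeDiagram (n : ℕ) : Diagram where
  verts := Finset.range n
  undir := ((Finset.range n) ×ˢ (Finset.range n)).filter (fun p => p.1 ≠ p.2)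
  dir := ∅

/-- The diagram associated to a simple 2-CNF formula: an undirected edge
`{x, y}` for each clause `(¬x ∨ ¬y)` and a directed edge `(x, y)` for each
clause `(¬x ∨ y)`. -/
def diagramOf (φ : Formula) : Diagram where
  verts := Vars φ
  undir := ((Vars φ) ×ˢ (Vars φ)).filter
    (fun p => ({(p.1, false), (p.2, false)} : Clause) ∈ φ)
  dir := ((Vars φ) ×ˢ (Vars φ)).filter
    (fun p => ({(p.1, false), (p.2, true)} : Clause) ∈ φ)

/-- A polarized diagram: a directed graph with a polarity on its edges
(`true` = `+`, `false` = `−`). -/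
structure PolDiagram where
  verts : Finset ℕ
  edges : Finset (ℕ × ℕ)
  pol : ℕ × ℕ → Bool

/-- `(P, P.pol)` is a polarized diagram of the diagram `G`: every undirected
edge of `G` is oriented (in exactly one way) with polarity `−`, and every
directed edge of `G` is kept with polarity `+`. -/
def IsPolarizationOf (P : PolDiagram) (G : Diagram) : Prop :=
  P.verts = G.verts ∧
  (∀ u v : ℕ, (u, v) ∈ G.dir ↔ ((u, v) ∈ P.edges ∧ P.pol (u, v) = true)) ∧
  (∀ u v : ℕ, (u, v) ∈ G.undir ↔
    (((u, v) ∈ P.edges ∧ P.pol (u, v) = false) ∨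
     ((v, u) ∈ P.edges ∧ P.pol (v, u) = false))) ∧
  (∀ u v : ℕ, ¬ ((u, v) ∈ P.edges ∧ (v, u) ∈ P.edges))

/-- A polarized rectifier network: base vertices, auxiliary vertices, directed
edges, and a polarity function (only meaningful on edges into base vertices). -/
structure PRN where
  base : Finset ℕ
  aux : Finset ℕ
  edges : Finset (ℕ × ℕ)
  pol : ℕ × ℕ → Bool

/-- Well-formedness of a PRN: base and auxiliary vertices are disjoint, and
edges are loopless edges between vertices. -/
def PRN.WF (R : PRN) : Prop :=
  Disjoint R.base R.aux ∧
  (∀ e ∈ R.edges, e.1 ∈ R.base ∪ R.aux ∧ e.2 ∈ R.base ∪ R.aux ∧ e.1 ≠ e.2)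

/-- A valid walk from the base vertex `u` to the base vertex `v`: a sequence of
length ≥ 2 of consecutive edges whose interior vertices are auxiliary. -/
def ValidWalk (R : PRN) (u v : ℕ) (π : List ℕ) : Prop :=
  2 ≤ π.length ∧
  π.head? = some u ∧ π.getLast? = some v ∧
  u ∈ R.base ∧ v ∈ R.base ∧
  List.Chain' (fun a b => (a, b) ∈ R.edges) π ∧
  (∀ i : ℕ, 0 < i → i + 1 < π.length → π.getD i 0 ∈ R.aux)

/-- The polarity of a walk: the polarity of its last edge. -/
def walkPol (R : PRN) (π : List ℕ) : Bool :=
  R.pol (π.getD (π.length - 2) 0, π.getD (π.length - 1) 0)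

/-- A strict polarized rectifier network: (1) for distinct base vertices `u, v`
there is at most one valid walk from `u` to `v` or from `v` to `u` in total, and
(2) every auxiliary vertex belongs to some valid walk. -/
def IsSPRN (R : PRN) : Prop :=
  (∀ u ∈ R.base, ∀ v ∈ R.base, u ≠ v →
    ∀ π₁ π₂ : List ℕ,
      (ValidWalk R u v π₁ ∨ ValidWalk R v u π₁) →
      (ValidWalk R u v π₂ ∨ ValidWalk R v u π₂) → π₁ = π₂) ∧
  (∀ a ∈ R.aux, ∃ u v : ℕ, ∃ π : List ℕ, ValidWalk R u v π ∧ a ∈ π)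

/-- The PRN `R` realizes the polarized diagram `P`. -/
def RealizesPol (R : PRN) (P : PolDiagram) : Prop :=
  R.base = P.verts ∧
  ∀ u ∈ P.verts, ∀ v ∈ P.verts,
    ((u, v) ∈ P.edges ↔ ∃ π : List ℕ, ValidWalk R u v π ∧ walkPol R π = P.pol (u, v))

/-- The PRN `R` realizes the diagram `G`: it realizes some polarized diagram of `G`. -/
def RealizesDiagram (R : PRN) (G : Diagram) : Prop :=
  ∃ P : PolDiagram, IsPolarizationOf P G ∧ RealizesPol R P

/-- The 2-CNF formula `F_R` associated to a PRN `R`. -/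
def PRN.formula (R : PRN) : Formula :=
  R.edges.image (fun e =>
    if e.2 ∈ R.base ∧ R.pol e = false
    then ({(e.1, false), (e.2, false)} : Clause)
    else ({(e.1, false), (e.2, true)} : Clause))

/-- The PRN associated to a polarized diagram (no auxiliary vertices). -/
def prnOfPol (P : PolDiagram) : PRN :=
  ⟨P.verts, ∅, P.edges, P.pol⟩

/-- A coherent biclique `(X, Y)` of a PRN. -/
def CoherentBiclique (R : PRN) (X Y : Finset ℕ) : Prop :=
  X.Nonempty ∧ Y.Nonempty ∧ Disjoint X Y ∧
  X ⊆ R.base ∪ R.aux ∧ Y ⊆ R.base ∪ R.aux ∧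
  (∀ x ∈ X, ∀ y ∈ Y, (x, y) ∈ R.edges) ∧
  (∀ y ∈ Y, y ∈ R.base → ∀ x₁ ∈ X, ∀ x₂ ∈ X, R.pol (x₁, y) = R.pol (x₂, y))

/-- `R'` is the biclique reduction of `R` with respect to some coherent biclique. -/
def BicliqueStep (R R' : PRN) : Prop :=
  ∃ (X Y : Finset ℕ) (z : ℕ),
    CoherentBiclique R X Y ∧
    z ∉ R.base ∪ R.aux ∧
    R'.base = R.base ∧
    R'.aux = insert z R.aux ∧
    R'.edges = (R.edges \ (X ×ˢ Y)) ∪ (X ×ˢ ({z} : Finset ℕ)) ∪ (({z} : Finset ℕ) ×ˢ Y) ∧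
    (∀ y ∈ Y, y ∈ R.base → ∀ x ∈ X, R'.pol (z, y) = R.pol (x, y)) ∧
    (∀ e ∈ R.edges \ (X ×ˢ Y), e.2 ∈ R.base → R'.pol e = R.pol e)

/-- `R ↪* R'`: the reflexive transitive closure of biclique reduction. -/
def BicliqueChain : PRN → PRN → Prop := Relation.ReflTransGen BicliqueStep

/-- The total degree (in-degree plus out-degree) of a vertex in a PRN. -/
def totalDeg (R : PRN) (v : ℕ) : ℕ :=
  (R.edges.filter (fun e => e.1 = v)).card + (R.edges.filter (fun e => e.2 = v)).card

/-- The set of two-literal clauses `{a, b}` with `a ∈ A` and `b ∈ B`. -/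
def biclique (A B : Finset Lit) : Finset Clause :=
  (A ×ˢ B).image (fun p => {p.1, p.2})

/-- The result of replacing every biclique `A k × B k`, for `k ∈ K`, by two stars centred at the
two literals of the variable `y k`. -/
def replaceBicliques {ι : Type*} (φ : Formula) (K : Finset ι) (A B : ι → Finset Lit)
    (y : ι → ℕ) : Formula :=
  (φ \ K.biUnion (fun k => biclique (A k) (B k)))
    ∪ K.biUnion (fun k => (A k).image (fun a => ({(y k, true), a} : Clause)))
    ∪ K.biUnion (fun k => (B k).image (fun b => ({(y k, false), b} : Clause)))

lemma mem_biclique {A B : Finset Lit} {C : Clause} :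
    C ∈ biclique A B ↔ ∃ a ∈ A, ∃ b ∈ B, C = {a, b} := by
  simp only [biclique, Finset.mem_image, Finset.mem_product]
  constructor
  · rintro ⟨⟨a, b⟩, ⟨ha, hb⟩, rfl⟩
    exact ⟨_, ha, _, hb, rfl⟩
  · rintro ⟨a, ha, b, hb, rfl⟩
    exact ⟨(a, b), ⟨ha, hb⟩, rfl⟩

lemma joinClauses_singletons (A B : Finset Lit) :
    JoinClauses (A.image singleton) (B.image singleton) = biclique A B := by
  ext C
  rw [mem_biclique]
  simp only [JoinClauses, Finset.mem_image, Finset.mem_product]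
  constructor
  · rintro ⟨⟨c, d⟩, ⟨⟨a, ha, hc⟩, b, hb, hd⟩, rfl⟩
    obtain rfl : {a} = c := hc
    obtain rfl : {b} = d := hd
    exact ⟨a, ha, b, hb, rfl⟩
  · rintro ⟨a, ha, b, hb, rfl⟩
    exact ⟨({a}, {b}), ⟨⟨a, ha, rfl⟩, b, hb, rfl⟩, rfl⟩

lemma fst_mem_vars {φ : Formula} {C : Clause} {l : Lit} (hC : C ∈ φ) (hl : l ∈ C) :
    l.1 ∈ Vars φ := by
  simp only [Vars, Finset.mem_biUnion]
  exact ⟨C, hC, Finset.mem_image_of_mem _ hl⟩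

lemma isClause_singleton (a : Lit) : IsClause {a} := by
  intro v ⟨h1, h2⟩
  rw [Finset.mem_singleton] at h1 h2
  simpa using h1.trans h2.symm

lemma isClause_pair {a b : Lit} (hab : a.1 ≠ b.1) :
    IsClause {a, b} ∧ ({a, b} : Clause).card = 2 := by
  constructor
  · intro v ⟨h1, h2⟩
    simp only [Finset.mem_insert, Finset.mem_singleton] at h1 h2
    rcases h1 with rfl | rfl <;> rcases h2 with h | h
    · simp at h
    · exact hab (by rw [← h])
    · exact hab (by rw [← h])
    · simp at h
  · exact Finset.card_pair (fun h => hab (by rw [h]))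

lemma sdiff_union_exchange {F U J p P q Q : Prop} (hP : P → ¬J) (hQ : Q → ¬J) :
    (((F ∧ ¬(J ∨ U)) ∨ (p ∨ P)) ∨ (q ∨ Q)) ↔ (((((F ∧ ¬U) ∨ P) ∨ Q) ∧ ¬J) ∨ p) ∨ q := by
  by_cases J <;> by_cases p <;> by_cases q <;> simp_all [or_assoc]

section Replace

variable {ι : Type*} {φ : Formula} {K : Finset ι} {A B : ι → Finset Lit} {y : ι → ℕ}
  {X : Finset ℕ}

lemma mem_replaceBicliques {C : Clause} :
    C ∈ replaceBicliques φ K A B y ↔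
      (C ∈ φ ∧ ∀ k ∈ K, C ∉ biclique (A k) (B k)) ∨
      (∃ k ∈ K, ∃ a ∈ A k, C = {(y k, true), a}) ∨
      (∃ k ∈ K, ∃ b ∈ B k, C = {(y k, false), b}) := by
  simp only [replaceBicliques, Finset.mem_union, Finset.mem_sdiff, Finset.mem_biUnion,
    Finset.mem_image, not_exists, not_and, or_assoc, eq_comm (a := C)]

lemma is2CNF_replaceBicliques (hφ : Is2CNF φ) (hA : ∀ k ∈ K, ∀ a ∈ A k, a.1 ∈ X)
    (hB : ∀ k ∈ K, ∀ b ∈ B k, b.1 ∈ X) (hy : ∀ k, y k ∉ X) :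
    Is2CNF (replaceBicliques φ K A B y) := by
  intro C hC
  rcases mem_replaceBicliques.1 hC with ⟨h, -⟩ | ⟨k, hk, a, ha, rfl⟩ | ⟨k, hk, a, ha, rfl⟩
  · exact hφ C h
  · exact isClause_pair (fun h => hy k (by have := hA k hk a ha; rwa [← h] at this))
  · exact isClause_pair (fun h => hy k (by have := hB k hk a ha; rwa [← h] at this))

lemma bvaChain_replaceBicliques (hX : Vars φ ⊆ X)
    (hA : ∀ k ∈ K, ∀ a ∈ A k, a.1 ∈ X) (hB : ∀ k ∈ K, ∀ b ∈ B k, b.1 ∈ X)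
    (hy : ∀ k, y k ∉ X) (hinj : Function.Injective y)
    (hsub : ∀ k ∈ K, biclique (A k) (B k) ⊆ φ)
    (hdisj : ∀ k ∈ K, ∀ k' ∈ K, k ≠ k' → ∀ C ∈ biclique (A k) (B k),
      C ∉ biclique (A k') (B k')) :
    BVAChain φ (replaceBicliques φ K A B y) := by
  classical
  induction K using Finset.induction_on with
  | empty =>
    have : replaceBicliques φ ∅ A B y = φ := by simp [replaceBicliques]
    rw [this]
    exact Relation.ReflTransGen.refl
  | insert k K hk ih =>
    have hK : ∀ k' ∈ K, k' ∈ insert k K := fun k' => Finset.mem_insert_of_mem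
    have hkk : k ∈ insert k K := Finset.mem_insert_self k K
    refine (ih (fun k' h => hA k' (hK _ h)) (fun k' h => hB k' (hK _ h))
      (fun k' h => hsub k' (hK _ h))
      (fun k₁ h₁ k₂ h₂ => hdisj k₁ (hK _ h₁) k₂ (hK _ h₂))).tail ?_
    have hnot : ∀ k' b, ∀ C ∈ φ, ((y k', b) : Lit) ∉ C := fun k' b C hC h =>
      hy k' (hX (fst_mem_vars hC h))
    refine ⟨(A k).image singleton, (B k).image singleton, y k, ?_, ?_, ?_, ?_, ?_⟩
    · simp only [Finset.mem_image]
      rintro _ ⟨a, -, rfl⟩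
      exact ⟨isClause_singleton a, Finset.singleton_nonempty a⟩
    · simp only [Finset.mem_image]
      rintro _ ⟨a, -, rfl⟩
      exact ⟨isClause_singleton a, Finset.singleton_nonempty a⟩
    · rw [joinClauses_singletons]
      intro C hC
      refine mem_replaceBicliques.2 (Or.inl ⟨hsub k hkk hC, fun k' hk' => ?_⟩)
      exact hdisj k hkk k' (hK _ hk') (fun h => hk (h ▸ hk')) C hC
    · intro hv
      simp only [Vars, Finset.mem_biUnion, Finset.mem_image] at hv
      obtain ⟨C, hC, l, hl, hlk⟩ := hv
      rcases mem_replaceBicliques.1 hC with ⟨h, -⟩ | ⟨k', hk', a, ha, rfl⟩ | ⟨k', hk', a, ha, rfl⟩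
      · exact hy k (hlk ▸ hX (fst_mem_vars h hl))
      · simp only [Finset.mem_insert, Finset.mem_singleton] at hl
        rcases hl with rfl | rfl
        · exact hk (hinj hlk ▸ hk')
        · exact hy k (hlk ▸ hA k' (hK _ hk') _ ha)
      · simp only [Finset.mem_insert, Finset.mem_singleton] at hl
        rcases hl with rfl | rfl
        · exact hk (hinj hlk ▸ hk')
        · exact hy k (hlk ▸ hB k' (hK _ hk') _ ha)
    · rw [joinClauses_singletons]
      have h1 : Disjoint (K.biUnion (fun k => (A k).image (fun a => ({(y k, true), a} : Clause))))
          (biclique (A k) (B k)) := by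
        rw [Finset.disjoint_left]
        intro C hC hC'
        simp only [Finset.mem_biUnion, Finset.mem_image] at hC
        obtain ⟨k', -, a, -, rfl⟩ := hC
        exact hnot k' true _ (hsub k hkk hC') (by simp)
      have h2 : Disjoint (K.biUnion (fun k => (B k).image (fun a => ({(y k, false), a} : Clause))))
          (biclique (A k) (B k)) := by
        rw [Finset.disjoint_left]
        intro C hC hC'
        simp only [Finset.mem_biUnion, Finset.mem_image] at hC
        obtain ⟨k', -, a, -, rfl⟩ := hC
        exact hnot k' false _ (hsub k hkk hC') (by simp)
      rw [Finset.disjoint_left] at h1 h2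
      simp only [replaceBicliques, Finset.biUnion_insert, Finset.image_image]
      ext C
      have h1 := @h1 C
      have h2 := @h2 C
      simp only [Finset.mem_union, Finset.mem_sdiff]
      have e1 : C ∈ (A k).image ((fun C => insert ((y k, true) : Lit) C) ∘ singleton) ↔
        C ∈ (A k).image (fun a => ({(y k, true), a} : Clause)) := Iff.rfl
      have e2 : C ∈ (B k).image ((fun C => insert ((y k, false) : Lit) C) ∘ singleton) ↔
        C ∈ (B k).image (fun a => ({(y k, false), a} : Clause)) := Iff.rfl
      rw [e1, e2]
      exact sdiff_union_exchange h1 h2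

end Replace

lemma exists_fresh (ι : Type*) [Countable ι] (X : Finset ℕ) :
    ∃ y : ι → ℕ, Function.Injective y ∧ ∀ k, y k ∉ X := by
  obtain ⟨f, hf⟩ := Countable.exists_injective_nat ι
  refine ⟨fun k => X.sup id + 1 + f k, fun a b h => hf (by simpa using h), fun k hk => ?_⟩
  have := Finset.le_sup (f := id) hk
  simp only [id] at this
  omega

/-- A finite set coloured with few colours splits into monochromatic pairs up to a
remainder of size at most the number of colours. -/
lemma exists_monochromatic_pairing {α : Type*} [DecidableEq α] (f : α → ℕ) (T : ℕ)
    (B : Finset α) (hB : ∀ c ∈ B, f c < T) :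
    ∃ M : Finset (Finset α),
      (∀ p ∈ M, p ⊆ B ∧ p.card = 2 ∧ ∀ c ∈ p, ∀ c' ∈ p, f c = f c') ∧
      (∀ p ∈ M, ∀ q ∈ M, ∀ c ∈ p, c ∈ q → p = q) ∧
      (B.filter (fun c => ∀ p ∈ M, c ∉ p)).card ≤ T ∧ 2 * M.card ≤ B.card := by
  induction B using Finset.strongInduction with
  | H B ih =>
    by_cases hT : B.card ≤ T
    · exact ⟨∅, by simp, by simp, (Finset.card_filter_le _ _).trans hT, by simp⟩
    · obtain ⟨a, ha, b, hb, hab, hf⟩ :=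
        Finset.exists_ne_map_eq_of_card_lt_of_maps_to (s := B) (t := Finset.range T) (f := f)
          (by simpa using hT) (fun c hc => by simpa using hB c hc)
      have hsub : ({a, b} : Finset α) ⊆ B := by
        intro c hc
        simp only [Finset.mem_insert, Finset.mem_singleton] at hc
        rcases hc with rfl | rfl <;> assumption
      have hss : B \ {a, b} ⊂ B := Finset.sdiff_ssubset hsub ⟨a, by simp⟩
      obtain ⟨M, hM1, hM2, hM3, hM4⟩ := ih _ hss (fun c hc => hB c (hss.1 hc))
      have hdis : ∀ p ∈ M, ∀ c ∈ p, c ∉ ({a, b} : Finset α) := fun p hp c hc =>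
        (Finset.mem_sdiff.1 ((hM1 p hp).1 hc)).2
      refine ⟨insert {a, b} M, ?_, ?_, ?_, ?_⟩
      · intro p hp
        rcases Finset.mem_insert.1 hp with rfl | hp
        · refine ⟨hsub, Finset.card_pair hab, ?_⟩
          simp only [Finset.mem_insert, Finset.mem_singleton]
          rintro c (rfl | rfl) c' (rfl | rfl) <;> simp [hf]
        · exact ⟨(hM1 p hp).1.trans hss.1, (hM1 p hp).2⟩
      · intro p hp q hq c hcp hcq
        rcases Finset.mem_insert.1 hp with rfl | hp <;> rcases Finset.mem_insert.1 hq with rfl | hq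
        · rfl
        · exact absurd hcp (hdis q hq c hcq)
        · exact absurd hcq (hdis p hp c hcp)
        · exact hM2 p hp q hq c hcp hcq
      · refine (Finset.card_le_card ?_).trans hM3
        intro c hc
        simp only [Finset.mem_filter, Finset.mem_insert, forall_eq_or_imp] at hc
        exact Finset.mem_filter.2 ⟨Finset.mem_sdiff.2 ⟨hc.1, by simpa using hc.2.1⟩, hc.2.2⟩
      · have h1 := Finset.card_insert_le ({a, b} : Finset α) M
        have h2 := Finset.card_sdiff_add_card_eq_card hsub
        rw [Finset.card_pair hab] at h2
        omega

lemma vars_replaceBicliques_subset {ι : Type*} {φ : Formula} {K : Finset ι}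
    {A B : ι → Finset Lit} {y : ι → ℕ} {X : Finset ℕ} (hX : Vars φ ⊆ X)
    (hA : ∀ k ∈ K, ∀ a ∈ A k, a.1 ∈ X) (hB : ∀ k ∈ K, ∀ b ∈ B k, b.1 ∈ X) :
    Vars (replaceBicliques φ K A B y) ⊆ X ∪ K.image y := by
  intro v hv
  simp only [Vars, Finset.mem_biUnion, Finset.mem_image] at hv
  obtain ⟨C, hC, l, hl, rfl⟩ := hv
  rw [Finset.mem_union]
  rcases mem_replaceBicliques.1 hC with ⟨h, -⟩ | ⟨k, hk, a, ha, rfl⟩ | ⟨k, hk, a, ha, rfl⟩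
  · exact Or.inl (hX (fst_mem_vars h hl))
  · rcases Finset.mem_insert.1 hl with rfl | hl
    · exact Or.inr (Finset.mem_image_of_mem y hk)
    · rw [Finset.mem_singleton.1 hl]
      exact Or.inl (hA k hk a ha)
  · rcases Finset.mem_insert.1 hl with rfl | hl
    · exact Or.inr (Finset.mem_image_of_mem y hk)
    · rw [Finset.mem_singleton.1 hl]
      exact Or.inl (hB k hk a ha)

/-- The members of `L` whose index lies in the `i`-th block of length `h`. -/
def strip (L : Finset Lit) (idx : Lit → ℕ) (h i : ℕ) : Finset Lit :=
  L.filter (fun c => idx c / h = i)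

/-- The literals `a ∈ A` for which `{a, c}` is a clause of `φ`. -/
def pattern (φ : Formula) (A : Finset Lit) (c : Lit) : Finset Lit :=
  A.filter (fun a => ({a, c} : Clause) ∈ φ)

/-- The literals lying beyond the strip `k.1` whose pattern on that strip is `k.2`. -/
def laterWithPattern (φ : Formula) (L : Finset Lit) (idx : Lit → ℕ) (h : ℕ)
    (k : ℕ × Finset Lit) : Finset Lit :=
  L.filter (fun c => k.1 < idx c / h ∧ pattern φ (strip L idx h k.1) c = k.2)

/-- All pairs of a strip number below `S` and a subset of that strip. -/
def stripPatterns (L : Finset Lit) (idx : Lit → ℕ) (h S : ℕ) : Finset (ℕ × Finset Lit) :=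
  (Finset.range S).biUnion (fun i => (strip L idx h i).powerset.image (Prod.mk i))

section Strips

variable {φ : Formula} {L : Finset Lit} {idx : Lit → ℕ} {h S : ℕ}

lemma mem_strip {i : ℕ} {c : Lit} : c ∈ strip L idx h i ↔ c ∈ L ∧ idx c / h = i :=
  Finset.mem_filter

lemma card_strip_le (hinj : Set.InjOn idx L) (hh : 0 < h) (i : ℕ) :
    (strip L idx h i).card ≤ h := by
  have : (strip L idx h i).card ≤ (Finset.Ico (i * h) (i * h + h)).card := by
    refine Finset.card_le_card_of_injOn idx (fun c hc => ?_)
      (hinj.mono fun c hc => (mem_strip.1 hc).1)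
    have hc := (mem_strip.1 hc).2
    rw [Nat.div_eq_iff hh] at hc
    simp only [Finset.coe_Ico, Set.mem_Ico]
    omega
  simpa using this

lemma mem_laterWithPattern {k : ℕ × Finset Lit} {c : Lit} :
    c ∈ laterWithPattern φ L idx h k ↔
      c ∈ L ∧ k.1 < idx c / h ∧ pattern φ (strip L idx h k.1) c = k.2 :=
  Finset.mem_filter

lemma mem_stripPatterns {k : ℕ × Finset Lit} :
    k ∈ stripPatterns L idx h S ↔ k.1 < S ∧ k.2 ⊆ strip L idx h k.1 := by
  obtain ⟨i, P⟩ := k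
  simp [stripPatterns]

lemma card_stripPatterns_le (hinj : Set.InjOn idx L) (hh : 0 < h) :
    (stripPatterns L idx h S).card ≤ S * 2 ^ h := by
  have := Finset.card_biUnion_le_card_mul (Finset.range S)
    (fun i => (strip L idx h i).powerset.image (Prod.mk i)) (2 ^ h) (fun i _ => by
      refine Finset.card_image_le.trans ?_
      rw [Finset.card_powerset]
      exact Nat.pow_le_pow_right (by norm_num) (card_strip_le hinj hh i))
  simpa [stripPatterns] using this

lemma biclique_laterWithPattern_subset (k : ℕ × Finset Lit) :
    biclique k.2 (laterWithPattern φ L idx h k) ⊆ φ := by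
  intro C hC
  obtain ⟨a, ha, c, hc, rfl⟩ := mem_biclique.1 hC
  rw [← (mem_laterWithPattern.1 hc).2.2] at ha
  exact (Finset.mem_filter.1 ha).2

lemma pair_eq_cases {a b c d : Lit} (he : ({a, b} : Clause) = {c, d}) :
    (a = c ∧ b = d) ∨ (a = d ∧ b = c) := by
  have := congrArg (fun s : Clause => (s : Set Lit)) he
  simp only [Finset.coe_insert, Finset.coe_singleton] at this
  exact Set.pair_eq_pair_iff.1 this

lemma biclique_laterWithPattern_disjoint {k k' : ℕ × Finset Lit}
    (hk : k ∈ stripPatterns L idx h S) (hk' : k' ∈ stripPatterns L idx h S) (hne : k ≠ k')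
    {C : Clause} (hC : C ∈ biclique k.2 (laterWithPattern φ L idx h k)) :
    C ∉ biclique k'.2 (laterWithPattern φ L idx h k') := by
  intro hC'
  obtain ⟨a, ha, c, hc, rfl⟩ := mem_biclique.1 hC
  obtain ⟨a', ha', c', hc', he⟩ := mem_biclique.1 hC'
  have h1 := (mem_strip.1 ((mem_stripPatterns.1 hk).2 ha)).2
  have h2 := (mem_strip.1 ((mem_stripPatterns.1 hk').2 ha')).2
  obtain ⟨-, h3, h4⟩ := mem_laterWithPattern.1 hc
  obtain ⟨-, h5, h6⟩ := mem_laterWithPattern.1 hc'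
  rcases pair_eq_cases he with ⟨rfl, rfl⟩ | ⟨rfl, rfl⟩
  · have h7 : k.1 = k'.1 := by omega
    exact hne (Prod.ext h7 (by rw [← h4, ← h6, h7]))
  · omega

lemma exists_strip_of_not_mem_biclique (hφ : Is2CNF φ) (hL : ∀ C ∈ φ, ∀ l ∈ C, l ∈ L)
    (hS : ∀ c ∈ L, idx c / h < S) {C : Clause} (hC : C ∈ φ)
    (hnot : ∀ k ∈ stripPatterns L idx h S, C ∉ biclique k.2 (laterWithPattern φ L idx h k)) :
    ∃ i < S, C ∈ biclique (strip L idx h i) (strip L idx h i) := by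
  obtain ⟨a, b, hab, rfl⟩ := Finset.card_eq_two.1 (hφ C hC).2
  have ha : a ∈ L := hL _ hC a (by simp)
  have hb : b ∈ L := hL _ hC b (by simp)
  have key : ∀ a ∈ L, ∀ b ∈ L, ({a, b} : Clause) ∈ φ → idx a / h < idx b / h →
      ∃ k ∈ stripPatterns L idx h S,
        ({a, b} : Clause) ∈ biclique k.2 (laterWithPattern φ L idx h k) := by
    intro a ha b hb hC hlt
    refine ⟨(idx a / h, pattern φ (strip L idx h (idx a / h)) b),
      mem_stripPatterns.2 ⟨hS a ha, Finset.filter_subset _ _⟩, mem_biclique.2 ⟨a, ?_, b, ?_, rfl⟩⟩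
    · exact Finset.mem_filter.2 ⟨mem_strip.2 ⟨ha, rfl⟩, hC⟩
    · exact mem_laterWithPattern.2 ⟨hb, hlt, rfl⟩
  rcases lt_trichotomy (idx a / h) (idx b / h) with hlt | heq | hlt
  · obtain ⟨k, hk, hk'⟩ := key a ha b hb hC hlt
    exact absurd hk' (hnot k hk)
  · exact ⟨idx a / h, hS a ha, mem_biclique.2
      ⟨a, mem_strip.2 ⟨ha, rfl⟩, b, mem_strip.2 ⟨hb, heq.symm⟩, rfl⟩⟩
  · rw [Finset.pair_comm] at hC hnot
    obtain ⟨k, hk, hk'⟩ := key b hb a ha hC hlt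
    exact absurd hk' (hnot k hk)

lemma sum_card_laterWithPattern_le :
    ∑ k ∈ stripPatterns L idx h S, (laterWithPattern φ L idx h k).card ≤
      ∑ c ∈ L, idx c / h := by
  have h1 : ∑ k ∈ stripPatterns L idx h S, (laterWithPattern φ L idx h k).card =
      ∑ i ∈ Finset.range S, (L.filter (fun c => i < idx c / h)).card := by
    rw [stripPatterns, Finset.sum_biUnion]
    · refine Finset.sum_congr rfl fun i _ => ?_
      rw [Finset.sum_image (fun _ _ _ _ he => (Prod.mk.inj he).2),
        Finset.card_eq_sum_card_fiberwise (f := pattern φ (strip L idx h i))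
          (t := (strip L idx h i).powerset)
          (fun c _ => by
            simp only [Finset.coe_powerset, Set.mem_preimage, Set.mem_powerset_iff]
            exact_mod_cast Finset.filter_subset _ _)]
      refine Finset.sum_congr rfl fun P _ => ?_
      rw [laterWithPattern, Finset.filter_filter]
    · intro i _ j _ hij
      simp only [Function.onFun, Finset.disjoint_left, Finset.mem_image]
      rintro _ ⟨P, -, rfl⟩ ⟨Q, -, he⟩
      exact hij (Prod.mk.inj he).1.symm
  rw [h1]
  simp only [Finset.card_filter]
  rw [Finset.sum_comm]
  refine Finset.sum_le_sum fun c _ => ?_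
  rw [← Finset.card_filter]
  calc _ ≤ (Finset.range (idx c / h)).card := Finset.card_le_card (fun i hi => by
        simpa using (Finset.mem_filter.1 hi).2)
    _ = _ := Finset.card_range _

lemma mul_sum_div_le {N : ℕ} (hinj : Set.InjOn idx L) (hN : ∀ c ∈ L, idx c < N) :
    h * (2 * ∑ c ∈ L, idx c / h) ≤ N ^ 2 := by
  have h1 : ∑ c ∈ L, idx c ≤ ∑ m ∈ Finset.range N, m := by
    rw [← Finset.sum_image (f := fun m => m) hinj]
    exact Finset.sum_le_sum_of_subset fun m hm => by
      obtain ⟨c, hc, rfl⟩ := Finset.mem_image.1 hm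
      exact Finset.mem_range.2 (hN c hc)
  have h2 : h * ∑ c ∈ L, idx c / h ≤ ∑ c ∈ L, idx c := by
    rw [Finset.mul_sum]
    exact Finset.sum_le_sum fun c _ => Nat.mul_div_le _ _
  have h3 := Finset.sum_range_id_mul_two N
  have h4 : N * (N - 1) ≤ N ^ 2 := by
    rw [sq]
    exact Nat.mul_le_mul_left _ (Nat.sub_le _ _)
  calc h * (2 * ∑ c ∈ L, idx c / h) = (h * ∑ c ∈ L, idx c / h) * 2 := by ring
    _ ≤ (∑ m ∈ Finset.range N, m) * 2 := Nat.mul_le_mul_right _ (h2.trans h1)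
    _ ≤ N ^ 2 := h3.trans_le h4

end Strips

lemma exists_index {α : Type*} (L : Finset α) :
    ∃ idx : α → ℕ, Set.InjOn idx L ∧ ∀ c ∈ L, idx c < L.card := by
  classical
  refine ⟨fun c => if hc : c ∈ L then (L.equivFin ⟨c, hc⟩ : ℕ) else 0, ?_, ?_⟩
  · intro a ha b hb hab
    have ha' : a ∈ L := ha
    have hb' : b ∈ L := hb
    simp only [ha', hb', dif_pos] at hab
    simpa using L.equivFin.injective (Fin.ext hab)
  · intro c hc
    simp only [hc, dif_pos]
    exact Fin.is_lt _

/-- Grouping literals by their pattern on strips of length `h`, and then pairing equal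
patterns inside blocks of length `w`, yields a short 2-CNF formula. -/
lemma exists_bvaChain_card_le {φ : Formula} (hφ : Is2CNF φ) {n h w : ℕ}
    (hn : (Vars φ).card ≤ n) (hh : 0 < h) (hw : 0 < w) :
    ∃ (φ' : Formula) (m : ℕ), Is2CNF φ' ∧ BVAChain φ φ' ∧ h * m ≤ n ^ 2 ∧
      φ'.card ≤ (2 * n / h + 1) * h ^ 2 + (2 * n / h + 1) * 2 ^ h * h
        + (2 * n / h + 1) * 2 ^ h * (2 * n / w + 1) + (2 * n / w + 1) * w ^ 2 * 2 + m := by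
  obtain ⟨L, hLdef⟩ : ∃ L, L = Vars φ ×ˢ (Finset.univ : Finset Bool) := ⟨_, rfl⟩
  have hmemL : ∀ l : Lit, l ∈ L ↔ l.1 ∈ Vars φ := fun l => by simp [hLdef]
  have hLcard : L.card ≤ 2 * n := by
    rw [hLdef, Finset.card_product]
    simp
    omega
  have hL : ∀ C ∈ φ, ∀ l ∈ C, l ∈ L := fun C hC l hl => (hmemL l).2 (fst_mem_vars hC hl)
  obtain ⟨idx, hinj, hidx⟩ := exists_index L
  replace hidx : ∀ c ∈ L, idx c < 2 * n := fun c hc => (hidx c hc).trans_le hLcard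
  set S := 2 * n / h + 1 with hSdef
  set T := 2 * n / w + 1 with hTdef
  have hS : ∀ c ∈ L, idx c / h < S := fun c hc =>
    Nat.lt_succ_of_le (Nat.div_le_div_right (hidx c hc).le)
  have hT : ∀ c ∈ L, idx c / w < T := fun c hc =>
    Nat.lt_succ_of_le (Nat.div_le_div_right (hidx c hc).le)
  set K₁ := stripPatterns L idx h S with hK₁
  set B₁ := laterWithPattern φ L idx h with hB₁
  have hB₁L : ∀ k, ∀ c ∈ B₁ k, c ∈ L := fun k c hc => (mem_laterWithPattern.1 hc).1
  have hK₁L : ∀ k ∈ K₁, ∀ a ∈ k.2, a ∈ L := fun k hk a ha =>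
    (mem_strip.1 ((mem_stripPatterns.1 hk).2 ha)).1
  have hA₁V : ∀ k ∈ K₁, ∀ a ∈ k.2, a.1 ∈ Vars φ := fun k hk a ha =>
    (hmemL a).1 (hK₁L k hk a ha)
  have hB₁V : ∀ k ∈ K₁, ∀ c ∈ B₁ k, c.1 ∈ Vars φ := fun k _ c hc =>
    (hmemL c).1 (hB₁L k c hc)
  obtain ⟨y, hy_inj, hy⟩ := exists_fresh (ℕ × Finset Lit) (Vars φ)
  obtain ⟨φ₁, hφ₁⟩ : ∃ φ₁, φ₁ = replaceBicliques φ K₁ Prod.snd B₁ y := ⟨_, rfl⟩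
  have hcnf₁ : Is2CNF φ₁ := hφ₁ ▸ is2CNF_replaceBicliques hφ hA₁V hB₁V hy
  have hchain₁ : BVAChain φ φ₁ := hφ₁ ▸ bvaChain_replaceBicliques subset_rfl hA₁V hB₁V hy hy_inj
    (fun k _ => biclique_laterWithPattern_subset k)
    (fun k hk k' hk' hne C hC => biclique_laterWithPattern_disjoint hk hk' hne hC)
  choose M hM_sub hM_disj hM_rest hM_card using fun k => exists_monochromatic_pairing
    (fun c => idx c / w) T (B₁ k) (fun c hc => hT c (hB₁L k c hc))
  set K₂ := (Finset.range T).biUnion (fun j => (strip L idx w j).powersetCard 2) with hK₂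
  have hMK₂ : ∀ k, ∀ p ∈ M k, p ∈ K₂ := by
    intro k p hp
    obtain ⟨hpB, hp2, hpc⟩ := hM_sub k p hp
    obtain ⟨c, hc⟩ : p.Nonempty := Finset.card_pos.1 (by omega)
    rw [hK₂, Finset.mem_biUnion]
    refine ⟨idx c / w, Finset.mem_range.2 (hT c (hB₁L k c (hpB hc))), ?_⟩
    rw [Finset.mem_powersetCard]
    exact ⟨fun c' hc' => mem_strip.2 ⟨hB₁L k c' (hpB hc'), hpc c' hc' c hc⟩, hp2⟩
  have hK₂L : ∀ p ∈ K₂, p.card = 2 ∧ ∀ c ∈ p, c ∈ L := by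
    intro p hp
    rw [hK₂, Finset.mem_biUnion] at hp
    obtain ⟨j, -, hp⟩ := hp
    rw [Finset.mem_powersetCard] at hp
    exact ⟨hp.2, fun c hc => (mem_strip.1 (hp.1 hc)).1⟩
  obtain ⟨B₂, hB₂⟩ : ∃ B₂ : Finset Lit → Finset Lit,
      ∀ p l, l ∈ B₂ p ↔ ∃ k ∈ K₁, p ∈ M k ∧ l = (y k, false) :=
    ⟨fun p => (K₁.filter (fun k => p ∈ M k)).image (fun k => (y k, false)), fun p l => by
      simp only [Finset.mem_image, Finset.mem_filter, and_assoc, eq_comm (a := l)]⟩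
  obtain ⟨X, hX⟩ : ∃ X, X = Vars φ ∪ K₁.image y := ⟨_, rfl⟩
  have hA₂X : ∀ p ∈ K₂, ∀ c ∈ p, c.1 ∈ X := fun p hp c hc => by
    rw [hX, Finset.mem_union]
    exact Or.inl ((hmemL c).1 ((hK₂L p hp).2 c hc))
  have hB₂X : ∀ p ∈ K₂, ∀ c ∈ B₂ p, c.1 ∈ X := fun p _ c hc => by
    obtain ⟨k, hk, -, rfl⟩ := (hB₂ p c).1 hc
    rw [hX, Finset.mem_union]
    exact Or.inr (Finset.mem_image_of_mem y hk)
  have hφ₁X : Vars φ₁ ⊆ X := by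
    rw [hφ₁, hX]
    exact vars_replaceBicliques_subset subset_rfl hA₁V hB₁V
  obtain ⟨z, hz_inj, hz⟩ := exists_fresh (Finset Lit) X
  have hLy : ∀ c ∈ L, ∀ k b, c ≠ (y k, b) := fun c hc k b he =>
    hy k (by have := (hmemL c).1 hc; rwa [he] at this)
  have hchain₂ : BVAChain φ₁ (replaceBicliques φ₁ K₂ id B₂ z) := by
    refine bvaChain_replaceBicliques hφ₁X hA₂X hB₂X hz hz_inj ?_ ?_
    · intro p hp C hC
      obtain ⟨c, hc, l, hl, rfl⟩ := mem_biclique.1 hC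
      obtain ⟨k, hk, hpk, rfl⟩ := (hB₂ p l).1 hl
      rw [hφ₁]
      exact mem_replaceBicliques.2 (Or.inr (Or.inr
        ⟨k, hk, c, (hM_sub k p hpk).1 hc, Finset.pair_comm _ _⟩))
    · intro p hp p' hp' hne C hC hC'
      obtain ⟨c, hc, l, hl, rfl⟩ := mem_biclique.1 hC
      obtain ⟨c', hc', l', hl', he⟩ := mem_biclique.1 hC'
      obtain ⟨k, hk, hpk, rfl⟩ := (hB₂ p l).1 hl
      obtain ⟨k', hk', hpk', rfl⟩ := (hB₂ p' l').1 hl'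
      rcases pair_eq_cases he with ⟨rfl, h2⟩ | ⟨h1, -⟩
      · obtain rfl : k = k' := hy_inj (Prod.mk.inj h2).1
        exact hne (hM_disj k p hpk p' hpk' c hc hc')
      · exact hLy c ((hK₂L p hp).2 c hc) k' false h1
  refine ⟨_, ∑ k ∈ K₁, (M k).card, is2CNF_replaceBicliques hcnf₁ hA₂X hB₂X hz,
    hchain₁.trans hchain₂, ?_, ?_⟩
  · have h1 : 2 * ∑ k ∈ K₁, (M k).card ≤ ∑ c ∈ L, idx c / h := by
      rw [Finset.mul_sum]
      exact (Finset.sum_le_sum fun k _ => hM_card k).trans sum_card_laterWithPattern_le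
    have h2 := mul_sum_div_le (h := h) hinj hidx
    have h3 := Nat.mul_le_mul_left h (Nat.mul_le_mul_left 2 h1)
    nlinarith
  · have hK₁card : K₁.card ≤ S * 2 ^ h := card_stripPatterns_le hinj hh
    have hK₂card : K₂.card ≤ T * w ^ 2 := by
      have := Finset.card_biUnion_le_card_mul (Finset.range T)
        (fun j => (strip L idx w j).powersetCard 2) (w ^ 2) (fun j _ => by
          rw [Finset.card_powersetCard]
          exact (Nat.choose_le_pow _ _).trans
            (Nat.pow_le_pow_left (card_strip_le hinj hw j) 2))
      simpa using this
    have hcover : replaceBicliques φ₁ K₂ id B₂ z ⊆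
        (Finset.range S).biUnion (fun i => biclique (strip L idx h i) (strip L idx h i))
        ∪ K₁.biUnion (fun k => k.2.image (fun a => ({(y k, true), a} : Clause)))
        ∪ K₁.biUnion (fun k => ((B₁ k).filter (fun c => ∀ p ∈ M k, c ∉ p)).image
            (fun c => ({(y k, false), c} : Clause)))
        ∪ K₂.biUnion (fun p => p.image (fun c => ({(z p, true), c} : Clause)))
        ∪ K₁.biUnion (fun k => (M k).image
            (fun p => ({(z p, false), (y k, false)} : Clause))) := by
      intro C hC
      simp only [Finset.mem_union, Finset.mem_biUnion, Finset.mem_image, Finset.mem_range,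
        Finset.mem_filter]
      rcases mem_replaceBicliques.1 hC with ⟨hC₁, hnot⟩ | ⟨p, hp, c, hc, rfl⟩ | ⟨p, hp, l, hl, rfl⟩
      · rw [hφ₁] at hC₁
        rcases mem_replaceBicliques.1 hC₁ with ⟨h0, hnot₁⟩ | ⟨k, hk, a, ha, rfl⟩ |
          ⟨k, hk, c, hc, rfl⟩
        · exact Or.inl (Or.inl (Or.inl (Or.inl
            (exists_strip_of_not_mem_biclique hφ hL hS h0 hnot₁))))
        · exact Or.inl (Or.inl (Or.inl (Or.inr ⟨k, hk, a, ha, rfl⟩)))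
        · refine Or.inl (Or.inl (Or.inr ⟨k, hk, c, ⟨hc, fun p hp hcp => ?_⟩, rfl⟩))
          exact hnot p (hMK₂ k p hp) (mem_biclique.2
            ⟨c, hcp, (y k, false), (hB₂ p _).2 ⟨k, hk, hp, rfl⟩, Finset.pair_comm _ _⟩)
      · exact Or.inl (Or.inr ⟨p, hp, c, hc, rfl⟩)
      · obtain ⟨k, hk, hpk, rfl⟩ := (hB₂ p l).1 hl
        exact Or.inr ⟨k, hk, p, hpk, rfl⟩
    refine (Finset.card_le_card hcover).trans ?_
    refine (Finset.card_union_le _ _).trans (Nat.add_le_add ?_ ?_)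
    · refine (Finset.card_union_le _ _).trans (Nat.add_le_add ?_ ?_)
      · refine (Finset.card_union_le _ _).trans (Nat.add_le_add ?_ ?_)
        · refine (Finset.card_union_le _ _).trans (Nat.add_le_add ?_ ?_)
          · refine (Finset.card_biUnion_le_card_mul _ _ (h ^ 2) fun i _ => ?_).trans ?_
            · refine Finset.card_image_le.trans ?_
              rw [Finset.card_product, sq]
              exact Nat.mul_le_mul (card_strip_le hinj hh i) (card_strip_le hinj hh i)
            · rw [Finset.card_range]
          · refine (Finset.card_biUnion_le_card_mul _ _ h fun k hk => ?_).trans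
              (Nat.mul_le_mul_right _ hK₁card)
            exact Finset.card_image_le.trans ((Finset.card_le_card
              (mem_stripPatterns.1 hk).2).trans (card_strip_le hinj hh _))
        · exact (Finset.card_biUnion_le_card_mul _ _ T fun k _ =>
            Finset.card_image_le.trans (hM_rest k)).trans (Nat.mul_le_mul_right _ hK₁card)
      · exact (Finset.card_biUnion_le_card_mul _ _ 2 fun p hp =>
          Finset.card_image_le.trans (hK₂L p hp).1.le).trans (Nat.mul_le_mul_right _ hK₂card)
    · exact Finset.card_biUnion_le.trans (Finset.sum_le_sum fun k _ => Finset.card_image_le)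

lemma exists_bvaChain_card_le_div {φ : Formula} (hφ : Is2CNF φ) {n h : ℕ} {ℓ Q c : ℝ}
    (hn : (Vars φ).card ≤ n) (hh : 0 < h) (hℓ : 1 ≤ ℓ) (hhℓ : (h : ℝ) ≤ ℓ)
    (hℓh : ℓ ≤ (1 + c) * h) (hQ : 1 ≤ Q) (hQn : Q ≤ n) (hpow : (2 : ℝ) ^ h * Q ^ 2 ≤ n)
    (hc : 27 * ℓ ^ 3 ≤ c * Q) :
    ∃ φ' : Formula, Is2CNF φ' ∧ BVAChain φ φ' ∧
      (φ'.card : ℝ) ≤ (1 + 2 * c) * (n : ℝ) ^ 2 / ℓ := by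
  have hQ0 : 0 < Q := by linarith
  have hℓ0 : 0 < ℓ := by linarith
  have hn1 : (1 : ℝ) ≤ n := hQ.trans hQn
  have hn0 : (0 : ℝ) < n := by linarith
  have hnQ : 1 ≤ (n : ℝ) / Q := (one_le_div hQ0).2 hQn
  set w := ⌈(n : ℝ) / Q⌉₊ with hwdef
  have hw_ge : (n : ℝ) / Q ≤ w := Nat.le_ceil _
  have hw_lt : (w : ℝ) < n / Q + 1 := Nat.ceil_lt_add_one (by positivity)
  have hw_le : (w : ℝ) ≤ 2 * (n / Q) := by linarith
  have hw0 : (0 : ℝ) < w := by linarith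
  have hwn : (w : ℝ) ≤ n := by
    have : w ≤ n := Nat.ceil_le.2 (div_le_self hn0.le hQ)
    exact_mod_cast this
  obtain ⟨φ', m, h2, hchain, hm, hcard⟩ :=
    exists_bvaChain_card_le hφ hn hh (by exact_mod_cast hw0 : 0 < w)
  refine ⟨φ', h2, hchain, ?_⟩
  obtain ⟨S, hS⟩ : ∃ S, S = 2 * n / h + 1 := ⟨_, rfl⟩
  obtain ⟨T, hT⟩ : ∃ T, T = 2 * n / w + 1 := ⟨_, rfl⟩
  rw [← hS, ← hT] at hcard
  have hS' : (S : ℝ) ≤ 3 * n := by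
    have h1 : S ≤ 2 * n + 1 := by
      rw [hS]
      exact Nat.succ_le_succ (Nat.div_le_self _ _)
    have h2 : (S : ℝ) ≤ 2 * n + 1 := by exact_mod_cast h1
    linarith
  have hTw : (T : ℝ) * w ≤ 3 * n := by
    have h1 : (T - 1 : ℝ) * w ≤ 2 * n := by
      have h2 : 2 * n / w * w ≤ 2 * n := Nat.div_mul_le_self _ _
      have h3 : (T : ℝ) - 1 = ((2 * n / w : ℕ) : ℝ) := by rw [hT]; push_cast; ring
      rw [h3]
      exact_mod_cast h2
    linarith
  have hTQ : (T : ℝ) ≤ 3 * Q := by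
    have h1 : (T : ℝ) * (n / Q) ≤ 3 * n :=
      (mul_le_mul_of_nonneg_left hw_ge (Nat.cast_nonneg T)).trans hTw
    rw [mul_div_assoc', div_le_iff₀ hQ0] at h1
    nlinarith
  have hpow' : (2 : ℝ) ^ h ≤ n / Q ^ 2 := (le_div_iff₀ (by positivity)).2 hpow
  have hm' : (m : ℝ) ≤ (1 + c) * n ^ 2 / ℓ := by
    have h1 : (h : ℝ) * m ≤ (n : ℝ) ^ 2 := by exact_mod_cast hm
    have hh0 : (0 : ℝ) < h := by exact_mod_cast hh
    rw [le_div_iff₀ hℓ0]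
    have hc0 : 0 ≤ 1 + c := by
      by_contra hneg
      nlinarith
    calc (m : ℝ) * ℓ ≤ m * ((1 + c) * h) := mul_le_mul_of_nonneg_left hℓh (Nat.cast_nonneg m)
      _ = (1 + c) * (h * m) := by ring
      _ ≤ (1 + c) * n ^ 2 := mul_le_mul_of_nonneg_left h1 hc0
  have hQsq : (n : ℝ) / Q ^ 2 ≤ n / Q :=
    div_le_div_of_nonneg_left hn0.le hQ0 (by nlinarith)
  have e1 : (S : ℝ) * h ^ 2 ≤ 3 * (n ^ 2 / Q) * ℓ ^ 2 := by
    have h1 : (S : ℝ) ≤ 3 * (n ^ 2 / Q) := by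
      have h2 : (n : ℝ) ≤ n ^ 2 / Q := by
        rw [le_div_iff₀ hQ0]
        nlinarith
      linarith
    gcongr
  have e2 : (S : ℝ) * 2 ^ h * h ≤ 3 * (n ^ 2 / Q) * ℓ ^ 2 := by
    calc (S : ℝ) * 2 ^ h * h ≤ (3 * n) * (n / Q) * ℓ := by
          gcongr
          exact hpow'.trans hQsq
      _ = 3 * (n ^ 2 / Q) * ℓ := by ring
      _ ≤ 3 * (n ^ 2 / Q) * ℓ ^ 2 := by
          gcongr
          nlinarith
  have e3 : (S : ℝ) * 2 ^ h * T ≤ 9 * (n ^ 2 / Q) * ℓ ^ 2 := by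
    calc (S : ℝ) * 2 ^ h * T ≤ (3 * n) * (n / Q ^ 2) * (3 * Q) := by gcongr
      _ = 9 * (n ^ 2 / Q) := by field_simp; ring
      _ ≤ 9 * (n ^ 2 / Q) * ℓ ^ 2 := le_mul_of_one_le_right (by positivity) (one_le_pow₀ hℓ)
  have e4 : (T : ℝ) * w ^ 2 * 2 ≤ 12 * (n ^ 2 / Q) * ℓ ^ 2 := by
    calc (T : ℝ) * w ^ 2 * 2 = (T * w) * w * 2 := by ring
      _ ≤ (3 * n) * (2 * (n / Q)) * 2 := by gcongr
      _ = 12 * (n ^ 2 / Q) := by ring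
      _ ≤ 12 * (n ^ 2 / Q) * ℓ ^ 2 := le_mul_of_one_le_right (by positivity) (one_le_pow₀ hℓ)
  have hcard' : (φ'.card : ℝ) ≤ S * h ^ 2 + S * 2 ^ h * h + S * 2 ^ h * T + T * w ^ 2 * 2 + m := by
    exact_mod_cast hcard
  have e5 : 27 * ((n : ℝ) ^ 2 / Q) * ℓ ^ 2 ≤ c * n ^ 2 / ℓ := by
    rw [le_div_iff₀ hℓ0]
    calc 27 * ((n : ℝ) ^ 2 / Q) * ℓ ^ 2 * ℓ = (n ^ 2 / Q) * (27 * ℓ ^ 3) := by ring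
      _ ≤ (n ^ 2 / Q) * (c * Q) := by gcongr
      _ = c * n ^ 2 := by field_simp
  calc (φ'.card : ℝ) ≤ 27 * ((n : ℝ) ^ 2 / Q) * ℓ ^ 2 + m := by linarith
    _ ≤ c * n ^ 2 / ℓ + (1 + c) * n ^ 2 / ℓ := add_le_add e5 hm'
    _ = (1 + 2 * c) * (n : ℝ) ^ 2 / ℓ := by ring

lemma eventually_logb_pow_le {c δ : ℝ} (hc : 0 < c) (hδ : 0 < δ) :
    ∀ᶠ n : ℕ in Filter.atTop, 27 * Real.logb 2 n ^ 3 ≤ c * (n : ℝ) ^ δ := by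
  have hlog : 0 < Real.log 2 := Real.log_pos one_lt_two
  have h := (isLittleO_log_rpow_rpow_atTop 3 hδ).bound
    (show 0 < c * Real.log 2 ^ 3 / 27 by positivity)
  filter_upwards [tendsto_natCast_atTop_atTop.eventually h, Filter.eventually_ge_atTop 1]
    with n hn hn1
  have hn1' : (1 : ℝ) ≤ n := by exact_mod_cast hn1
  rw [Real.norm_of_nonneg (Real.rpow_nonneg (Real.log_nonneg hn1') _),
    Real.norm_of_nonneg (by positivity)] at hn
  have e : Real.log n ^ (3 : ℝ) = Real.log n ^ 3 := by
    exact_mod_cast Real.rpow_natCast (Real.log n) 3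
  rw [e] at hn
  rw [Real.logb, div_pow, mul_div_assoc', div_le_iff₀ (by positivity)]
  linarith

/-- idealized BVA upper bound for arbitrary 2-CNF formulas. -/
theorem bva_general_upper (ε : ℝ) (hε : 0 < ε) :
    ∃ N : ℕ, ∀ n : ℕ, N ≤ n → ∀ φ : Formula, Is2CNF φ → (Vars φ).card ≤ n →
      ∃ φ' : Formula, Is2CNF φ' ∧ BVAChain φ φ' ∧
        (φ'.card : ℝ) ≤ (1 + ε) * (n : ℝ) ^ 2 / Real.logb 2 (n : ℝ) := by
  obtain ⟨δ, hδ⟩ : ∃ δ : ℝ, δ = (1 - 1 / (1 + ε / 2)) / 2 := ⟨_, rfl⟩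
  have hinv : 1 / (1 + ε / 2) < 1 := by
    rw [div_lt_one (by positivity)]
    linarith
  have hinv0 : 0 < 1 / (1 + ε / 2) := by positivity
  have hδ0 : 0 < δ := by linarith
  have hδ1 : δ < 1 / 2 := by linarith
  have hlogb : Filter.Tendsto (fun n : ℕ => Real.logb 2 n) Filter.atTop Filter.atTop :=
    (Real.tendsto_logb_atTop one_lt_two).comp tendsto_natCast_atTop_atTop
  have hev : ∀ᶠ n : ℕ in Filter.atTop, 1 ≤ n ∧ 1 / δ ≤ Real.logb 2 n ∧
      27 * Real.logb 2 n ^ 3 ≤ ε / 2 * (n : ℝ) ^ (δ / 2) :=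
    (Filter.eventually_ge_atTop 1).and ((hlogb.eventually_ge_atTop _).and
      (eventually_logb_pow_le (by positivity) (by positivity)))
  obtain ⟨N, hN⟩ := Filter.eventually_atTop.1 hev
  refine ⟨N, fun n hn φ hφ hcard => ?_⟩
  obtain ⟨hn1, hℓδ, hlog⟩ := hN n hn
  have hn1' : (1 : ℝ) ≤ n := by exact_mod_cast hn1
  have hn0 : (0 : ℝ) < n := by linarith
  set ℓ := Real.logb 2 n with hℓ
  have hδℓ : 1 ≤ δ * ℓ := by
    rw [div_le_iff₀ hδ0] at hℓδ
    linarith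
  have hℓ1 : 1 ≤ ℓ := by nlinarith
  have hprod : 1 ≤ (1 - δ) * ℓ := by nlinarith
  have hfloor_le : (⌊(1 - δ) * ℓ⌋₊ : ℝ) ≤ (1 - δ) * ℓ := Nat.floor_le (by linarith)
  have hlt_floor : (1 - δ) * ℓ < ⌊(1 - δ) * ℓ⌋₊ + 1 := Nat.lt_floor_add_one _
  have hpow : (2 : ℝ) ^ ⌊(1 - δ) * ℓ⌋₊ ≤ (n : ℝ) ^ (1 - δ) := by
    rw [← Real.rpow_natCast]
    calc (2 : ℝ) ^ (⌊(1 - δ) * ℓ⌋₊ : ℝ) ≤ 2 ^ ((1 - δ) * ℓ) :=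
          Real.rpow_le_rpow_of_exponent_le one_le_two hfloor_le
      _ = (n : ℝ) ^ (1 - δ) := by
          rw [mul_comm, Real.rpow_mul zero_le_two, hℓ,
            Real.rpow_logb zero_lt_two (by norm_num) hn0]
  have hmain := exists_bvaChain_card_le_div (c := ε / 2) (Q := (n : ℝ) ^ (δ / 2)) hφ hcard
    (Nat.floor_pos.2 hprod) hℓ1 (hfloor_le.trans (by nlinarith)) ?_
    (Real.one_le_rpow hn1' (by linarith)) ?_ ?_ hlog
  · rwa [mul_div_cancel₀ ε two_ne_zero] at hmain
  · have h1 : ℓ * (1 / (1 + ε / 2)) ≤ ⌊(1 - δ) * ℓ⌋₊ := by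
      have : 1 / (1 + ε / 2) = 1 - 2 * δ := by linarith
      rw [this]
      linarith
    rw [mul_one_div, div_le_iff₀ (by positivity)] at h1
    linarith
  · calc (n : ℝ) ^ (δ / 2) ≤ (n : ℝ) ^ (1 : ℝ) :=
          Real.rpow_le_rpow_of_exponent_le hn1' (by linarith)
      _ = n := Real.rpow_one _
  · calc (2 : ℝ) ^ ⌊(1 - δ) * ℓ⌋₊ * ((n : ℝ) ^ (δ / 2)) ^ 2
        ≤ (n : ℝ) ^ (1 - δ) * ((n : ℝ) ^ (δ / 2)) ^ 2 := by gcongr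
      _ = (n : ℝ) ^ (1 - δ) * (n : ℝ) ^ δ := by
          rw [← Real.rpow_natCast, ← Real.rpow_mul hn0.le]
          congr 2
          push_cast
          ring
      _ = n := by
          rw [← Real.rpow_add hn0, sub_add_cancel, Real.rpow_one]

end BVAPaper
end

section
/- For every real ε > 0 there exists N such that for every n ≥ N there exists a 2-CNF formula φ with exactly n variables such that every formula φ' with φ ⊢* φ' satisfies |φ'| ≥ (1 − ε) · n² / log₂ n. -/
namespace BVAPaper

/-- Some expansion in `S` sends the literal `l` into `{a}`. -/
def CanCollapse (S : Set (Lit → Finset Lit)) (a l : Lit) : Prop := ∃ s ∈ S, s l ⊆ {a}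

/-- Every expansion in `S` sends the set `G` to a set of at least two literals. -/
def IsSound (S : Set (Lit → Finset Lit)) (G : Finset Lit) : Prop :=
  ∀ s ∈ S, 2 ≤ (G.biUnion s).card

/-- Collapses onto a single literal, and cyclic triples of collapses, can be carried out
simultaneously by one expansion in `S`. -/
structure IsRegular (S : Set (Lit → Finset Lit)) : Prop where
  collapse : ∀ a, ∃ s ∈ S, ∀ l, CanCollapse S a l → s l ⊆ {a}
  cyclic : ∀ a b c, ∃ s ∈ S, ∀ l,
    (CanCollapse S a l → ¬ CanCollapse S b l → a ∈ s l) ∧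
    (CanCollapse S b l → ¬ CanCollapse S c l → b ∈ s l) ∧
    (CanCollapse S c l → ¬ CanCollapse S a l → c ∈ s l)

lemma IsSound.mono {S : Set (Lit → Finset Lit)} {G H : Finset Lit} (hG : IsSound S G)
    (h : G ⊆ H) : IsSound S H := fun s hs =>
  (hG s hs).trans (Finset.card_le_card (Finset.biUnion_subset_biUnion_of_subset_left s h))

lemma IsRegular.isSound_iff {S : Set (Lit → Finset Lit)} (hS : IsRegular S) {G : Finset Lit} :
    IsSound S G ↔ ∀ a, ∃ l ∈ G, ¬ CanCollapse S a l := by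
  constructor
  · intro h a
    by_contra! hc
    obtain ⟨s, hs, hsa⟩ := hS.collapse a
    have h1 : G.biUnion s ⊆ {a} := Finset.biUnion_subset.2 fun l hl => hsa l (hc l hl)
    have := (h s hs).trans (Finset.card_le_card h1)
    simp at this
  · intro h s hs
    by_contra! hc
    obtain ⟨a, ha⟩ := Finset.card_le_one_iff_subset_singleton.1 (Nat.lt_succ_iff.1 hc)
    obtain ⟨l, hl, hla⟩ := h a
    exact hla ⟨s, hs, (Finset.subset_biUnion_of_mem s hl).trans ha⟩

lemma IsRegular.exists_of_not_isSound {S : Set (Lit → Finset Lit)} (hS : IsRegular S)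
    {G : Finset Lit} (h : ¬ IsSound S G) : ∃ a, ∀ l ∈ G, CanCollapse S a l := by
  rw [hS.isSound_iff] at h
  push Not at h
  exact h

lemma IsRegular.exists_not_canCollapse {S : Set (Lit → Finset Lit)} (hS : IsRegular S)
    {G H : Finset Lit} {a : Lit} (h : IsSound S (G ∪ H)) (hG : ∀ l ∈ G, CanCollapse S a l) :
    ∃ l ∈ H, ¬ CanCollapse S a l := by
  obtain ⟨l, hl, hla⟩ := hS.isSound_iff.1 h a
  rcases Finset.mem_union.1 hl with h1 | h1
  · exact absurd (hG l h1) hla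
  · exact ⟨l, h1, hla⟩

lemma ne_of_canCollapse {S : Set (Lit → Finset Lit)} {a b l : Lit} (h : CanCollapse S a l)
    (h' : ¬ CanCollapse S b l) : a ≠ b := by
  rintro rfl
  exact h' h

lemma three_le_card {T : Finset Lit} {a b c : Lit} (ha : a ∈ T) (hb : b ∈ T) (hc : c ∈ T)
    (hab : a ≠ b) (hbc : b ≠ c) (hca : c ≠ a) : 3 ≤ T.card := by
  rw [← Finset.card_eq_three.2 ⟨a, b, c, hab, hca.symm, hbc, rfl⟩]
  refine Finset.card_le_card ?_
  intro x hx
  simp only [Finset.mem_insert, Finset.mem_singleton] at hx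
  rcases hx with rfl | rfl | rfl <;> assumption

/-- A set whose expansions all have exactly two literals contains a sound set of at most
two literals. -/
lemma IsRegular.exists_small_isSound {S : Set (Lit → Finset Lit)} (hS : IsRegular S)
    {F : Finset Lit} (hF : ∀ s ∈ S, (F.biUnion s).card = 2) :
    ∃ G ⊆ F, G.card ≤ 2 ∧ IsSound S G := by
  classical
  obtain ⟨G, hG, hmin⟩ := Finset.exists_min_image (F.powerset.filter (IsSound S)) Finset.card
    ⟨F, Finset.mem_filter.2 ⟨Finset.mem_powerset_self F, fun s hs => (hF s hs).ge⟩⟩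
  obtain ⟨hGF, hGs⟩ : G ⊆ F ∧ IsSound S G := by simpa using hG
  refine ⟨G, hGF, ?_, hGs⟩
  by_contra! hc
  have key : ∀ l ∈ G, ∃ a, ¬ CanCollapse S a l ∧ ∀ k ∈ G, k ≠ l → CanCollapse S a k := by
    intro l hl
    have hns : ¬ IsSound S (G.erase l) := by
      intro h
      have := hmin (G.erase l) (by simpa using ⟨(Finset.erase_subset _ _).trans hGF, h⟩)
      have := Finset.card_erase_lt_of_mem hl
      omega
    obtain ⟨a, ha⟩ := hS.exists_of_not_isSound hns
    refine ⟨a, ?_, fun k hk hkl => ha k (Finset.mem_erase.2 ⟨hkl, hk⟩)⟩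
    obtain ⟨k, hk, hka⟩ := hS.isSound_iff.1 hGs a
    by_cases hkl : k = l
    · exact hkl ▸ hka
    · exact absurd (ha k (Finset.mem_erase.2 ⟨hkl, hk⟩)) hka
  obtain ⟨l₁, l₂, l₃, h₁, h₂, h₃, h₁₂, h₁₃, h₂₃⟩ := Finset.two_lt_card_iff.1 hc
  obtain ⟨a₁, n₁, c₁⟩ := key l₁ h₁
  obtain ⟨a₂, n₂, c₂⟩ := key l₂ h₂
  obtain ⟨a₃, n₃, c₃⟩ := key l₃ h₃
  obtain ⟨s, hs, hcyc⟩ := hS.cyclic a₂ a₁ a₃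
  have m₁ := (hcyc l₁).1 (c₂ l₁ h₁ h₁₂) n₁
  have m₃ := (hcyc l₃).2.1 (c₁ l₃ h₃ h₁₃.symm) n₃
  have m₂ := (hcyc l₂).2.2 (c₃ l₂ h₂ h₂₃) n₂
  have := three_le_card (T := F.biUnion s) (Finset.mem_biUnion.2 ⟨l₁, hGF h₁, m₁⟩)
    (Finset.mem_biUnion.2 ⟨l₃, hGF h₃, m₃⟩) (Finset.mem_biUnion.2 ⟨l₂, hGF h₂, m₂⟩)
    (ne_of_canCollapse (c₂ l₁ h₁ h₁₂) n₁) (ne_of_canCollapse (c₁ l₃ h₃ h₁₃.symm) n₃)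
    (ne_of_canCollapse (c₃ l₂ h₂ h₂₃) n₂)
  have := hF s hs
  omega

lemma IsRegular.isSound_union_of_not_isSound {S : Set (Lit → Finset Lit)} (hS : IsRegular S)
    {C D G H : Finset Lit}
    (hCD : ∀ s ∈ S, ((C ∪ D).biUnion s).card = 2) (hH : H ⊆ D)
    (hC : ¬ IsSound S C) (hD : ¬ IsSound S D)
    (hGD : IsSound S (G ∪ D)) (hHC : IsSound S (H ∪ C)) : IsSound S (G ∪ H) := by
  by_contra hns
  obtain ⟨x, hx⟩ := hS.exists_of_not_isSound hns
  obtain ⟨a, ha⟩ := hS.exists_of_not_isSound hC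
  obtain ⟨b, hb⟩ := hS.exists_of_not_isSound hD
  obtain ⟨q, hq, hqa⟩ := hS.exists_not_canCollapse (Finset.union_comm H C ▸ hHC) ha
  have hCDs : IsSound S (D ∪ C) := fun s hs => (Finset.union_comm C D ▸ hCD s hs).ge
  obtain ⟨r, hr, hrb⟩ := hS.exists_not_canCollapse hCDs hb
  obtain ⟨r', hr', hrx⟩ := hS.exists_not_canCollapse hGD
    fun l hl => hx l (Finset.mem_union_left _ hl)
  have hqx := hx q (Finset.mem_union_right _ hq)
  obtain ⟨s, hs, hcyc⟩ := hS.cyclic x a b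
  have := three_le_card (T := (C ∪ D).biUnion s)
    (Finset.mem_biUnion.2 ⟨q, Finset.mem_union_right _ (hH hq), (hcyc q).1 hqx hqa⟩)
    (Finset.mem_biUnion.2 ⟨r, Finset.mem_union_left _ hr, (hcyc r).2.1 (ha r hr) hrb⟩)
    (Finset.mem_biUnion.2 ⟨r', Finset.mem_union_right _ hr', (hcyc r').2.2 (hb r' hr') hrx⟩)
    (ne_of_canCollapse hqx hqa) (ne_of_canCollapse (ha r hr) hrb)
    (ne_of_canCollapse (hb r' hr') hrx)
  have := hCD s hs
  omega

lemma biUnion_eq_of_isSound {S : Set (Lit → Finset Lit)} {C D : Finset Lit} (hC : IsSound S C)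
    (hCD : ∀ s ∈ S, ((C ∪ D).biUnion s).card = 2) (s : Lit → Finset Lit) (hs : s ∈ S) :
    C.biUnion s = (C ∪ D).biUnion s :=
  Finset.eq_of_subset_of_card_le
    (Finset.biUnion_subset_biUnion_of_subset_left s Finset.subset_union_left)
    ((hCD s hs).trans_le (hC s hs))

lemma IsRegular.isSound_union_of_isSound {S : Set (Lit → Finset Lit)} (hS : IsRegular S)
    {C D C₁ D₁ G H : Finset Lit}
    (hCD : ∀ s ∈ S, ((C ∪ D).biUnion s).card = 2)
    (hCD₁ : ∀ s ∈ S, ((C ∪ D₁).biUnion s).card = 2)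
    (hDC₁ : ∀ s ∈ S, ((D ∪ C₁).biUnion s).card = 2)
    (hDC₁₁ : ∀ s ∈ S, ((D₁ ∪ C₁).biUnion s).card = 2)
    (hH : H ⊆ D) (hC : IsSound S C) (hD : IsSound S D)
    (hC₁ : ¬ IsSound S C₁) (hD₁ : ¬ IsSound S D₁)
    (hGD : IsSound S (G ∪ D₁)) (hHC : IsSound S (H ∪ C₁)) : IsSound S (G ∪ H) := by
  by_contra hns
  obtain ⟨x, hx⟩ := hS.exists_of_not_isSound hns
  obtain ⟨a, ha⟩ := hS.exists_of_not_isSound hC₁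
  obtain ⟨b, hb⟩ := hS.exists_of_not_isSound hD₁
  obtain ⟨q, hq, hqa⟩ := hS.exists_not_canCollapse (Finset.union_comm H C₁ ▸ hHC) ha
  obtain ⟨r, hr, hrb⟩ := hS.exists_not_canCollapse (fun s hs => (hDC₁₁ s hs).ge) hb
  obtain ⟨r', hr', hrx⟩ := hS.exists_not_canCollapse hGD
    fun l hl => hx l (Finset.mem_union_left _ hl)
  have hqx := hx q (Finset.mem_union_right _ hq)
  obtain ⟨s, hs, hcyc⟩ := hS.cyclic x a b
  have hxm : x ∈ D.biUnion s := Finset.mem_biUnion.2 ⟨q, hH hq, (hcyc q).1 hqx hqa⟩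
  have ham : a ∈ D.biUnion s := by
    rw [biUnion_eq_of_isSound hD hDC₁ s hs]
    exact Finset.mem_biUnion.2 ⟨r, Finset.mem_union_right _ hr, (hcyc r).2.1 (ha r hr) hrb⟩
  have hbm : b ∈ C.biUnion s := by
    rw [biUnion_eq_of_isSound hC hCD₁ s hs]
    exact Finset.mem_biUnion.2 ⟨r', Finset.mem_union_right _ hr', (hcyc r').2.2 (hb r' hr') hrx⟩
  have hDsub : D.biUnion s ⊆ (C ∪ D).biUnion s :=
    Finset.biUnion_subset_biUnion_of_subset_left s Finset.subset_union_right
  have hCsub : C.biUnion s ⊆ (C ∪ D).biUnion s :=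
    Finset.biUnion_subset_biUnion_of_subset_left s Finset.subset_union_left
  have := three_le_card (hDsub hxm) (hDsub ham) (hCsub hbm)
    (ne_of_canCollapse hqx hqa) (ne_of_canCollapse (ha r hr) hrb)
    (ne_of_canCollapse (hb r' hr') hrx)
  have := hCD s hs
  omega

/-- The substitutes `𝒜`, `ℬ` for the two literals of the variable introduced by a BVA step with
respect to `𝒞`, `𝒟`: the formula stays an expansion of `φ₀` and resolution on the new variable
preserves soundness. -/
lemma IsRegular.exists_substitutes {S : Set (Lit → Finset Lit)} (hS : IsRegular S) {φ₀ : Formula}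
    (hφ₀ : ∀ E ∈ φ₀, E.card = 2) {𝒞 𝒟 : Finset Clause} (h𝒞 : 𝒞.Nonempty) (h𝒟 : 𝒟.Nonempty)
    (hexp : ∀ C ∈ 𝒞, ∀ D ∈ 𝒟, ∀ s ∈ S, (C ∪ D).biUnion s ∈ φ₀) :
    ∃ 𝒜 ℬ : Set Clause, 𝒜.Nonempty ∧ ℬ.Nonempty ∧
      (∀ C ∈ 𝒞, ∀ A ∈ 𝒜, ∀ s ∈ S, (C ∪ A).biUnion s ∈ φ₀) ∧
      (∀ D ∈ 𝒟, ∀ B ∈ ℬ, ∀ s ∈ S, (D ∪ B).biUnion s ∈ φ₀) ∧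
      (∀ C ∈ 𝒞, ∀ D ∈ 𝒟, ∀ G ⊆ C, ∀ H ⊆ D, (∀ A ∈ 𝒜, IsSound S (G ∪ A)) →
        (∀ B ∈ ℬ, IsSound S (H ∪ B)) → IsSound S (G ∪ H)) := by
  have hcard : ∀ C ∈ 𝒞, ∀ D ∈ 𝒟, ∀ s ∈ S, ((C ∪ D).biUnion s).card = 2 :=
    fun C hC D hD s hs => hφ₀ _ (hexp C hC D hD s hs)
  have hexp' : ∀ D ∈ 𝒟, ∀ C ∈ 𝒞, ∀ s ∈ S, (D ∪ C).biUnion s ∈ φ₀ :=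
    fun D hD C hC => Finset.union_comm C D ▸ hexp C hC D hD
  have hcard' : ∀ D ∈ 𝒟, ∀ C ∈ 𝒞, ∀ s ∈ S, ((D ∪ C).biUnion s).card = 2 :=
    fun D hD C hC s hs => hφ₀ _ (hexp' D hD C hC s hs)
  by_cases hD' : ∀ D ∈ 𝒟, IsSound S D
  · obtain ⟨C₀, hC₀⟩ := h𝒞
    refine ⟨𝒟, {∅}, h𝒟, ⟨∅, rfl⟩, hexp, ?_, ?_⟩
    · rintro D hD _ rfl s hs
      rw [Finset.union_empty, biUnion_eq_of_isSound (hD' D hD) (hcard' D hD C₀ hC₀) s hs]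
      exact hexp' D hD C₀ hC₀ s hs
    · intro C _ D _ G _ H _ _ hB
      exact (by simpa using hB ∅ rfl : IsSound S H).mono Finset.subset_union_right
  by_cases hC' : ∀ C ∈ 𝒞, IsSound S C
  · obtain ⟨D₀, hD₀⟩ := h𝒟
    refine ⟨{∅}, 𝒞, ⟨∅, rfl⟩, h𝒞, ?_, hexp', ?_⟩
    · rintro C hC _ rfl s hs
      rw [Finset.union_empty, biUnion_eq_of_isSound (hC' C hC) (hcard C hC D₀ hD₀) s hs]
      exact hexp C hC D₀ hD₀ s hs
    · intro C _ D _ G _ H _ hA _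
      exact (by simpa using hA ∅ rfl : IsSound S G).mono Finset.subset_union_left
  push Not at hC' hD'
  obtain ⟨C₁, hC₁, hC₁s⟩ := hC'
  obtain ⟨D₁, hD₁, hD₁s⟩ := hD'
  refine ⟨{D | D ∈ 𝒟 ∧ ¬ IsSound S D}, {C | C ∈ 𝒞 ∧ ¬ IsSound S C}, ⟨D₁, hD₁, hD₁s⟩,
    ⟨C₁, hC₁, hC₁s⟩, fun C hC A hA => hexp C hC A hA.1, fun D hD B hB => hexp' D hD B hB.1, ?_⟩
  intro C hC D hD G hG H hH hA hB
  by_cases hDs : IsSound S D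
  · by_cases hCs : IsSound S C
    · exact hS.isSound_union_of_isSound (hcard C hC D hD) (hcard C hC D₁ hD₁)
        (hcard' D hD C₁ hC₁) (hcard' D₁ hD₁ C₁ hC₁) hH hCs hDs hC₁s hD₁s
        (hA D₁ ⟨hD₁, hD₁s⟩) (hB C₁ ⟨hC₁, hC₁s⟩)
    · rw [Finset.union_comm]
      exact hS.isSound_union_of_not_isSound (hcard' D₁ hD₁ C hC) hG hD₁s hCs
        (hB C ⟨hC, hCs⟩) (hA D₁ ⟨hD₁, hD₁s⟩)
  · exact hS.isSound_union_of_not_isSound (hcard C₁ hC₁ D hD) hH hC₁s hDs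
      (hA D ⟨hD, hDs⟩) (hB C₁ ⟨hC₁, hC₁s⟩)

/-- Extend the expansions in `S` to the two literals of the variable `y`, which are first replaced
by a clause in `𝒜` and by a clause in `ℬ`, respectively. -/
def extendWith (S : Set (Lit → Finset Lit)) (y : ℕ) (𝒜 ℬ : Set Clause) :
    Set (Lit → Finset Lit) :=
  {t | ∃ s ∈ S, ∃ A ∈ 𝒜, ∃ B ∈ ℬ, t (y, true) = A.biUnion s ∧ t (y, false) = B.biUnion s ∧
    ∀ l : Lit, l.1 ≠ y → t l = s l}

lemma exists_mem_extendWith {S : Set (Lit → Finset Lit)} (y : ℕ) {𝒜 ℬ : Set Clause}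
    {s : Lit → Finset Lit} (hs : s ∈ S) {A B : Clause} (hA : A ∈ 𝒜) (hB : B ∈ ℬ) :
    ∃ t ∈ extendWith S y 𝒜 ℬ, t (y, true) = A.biUnion s ∧ t (y, false) = B.biUnion s ∧
      ∀ l : Lit, l.1 ≠ y → t l = s l := by
  have h : ∃ t : Lit → Finset Lit, t (y, true) = A.biUnion s ∧ t (y, false) = B.biUnion s ∧
      ∀ l : Lit, l.1 ≠ y → t l = s l := by
    refine ⟨fun l => if l.1 = y then (if l.2 then A.biUnion s else B.biUnion s) else s l,
      by simp, by simp, ?_⟩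
    intro l hl
    simp [hl]
  obtain ⟨t, ht⟩ := h
  exact ⟨t, ⟨s, hs, A, hA, B, hB, ht⟩, ht⟩

lemma canCollapse_extendWith_iff {S : Set (Lit → Finset Lit)} {y : ℕ} {𝒜 ℬ : Set Clause}
    (h𝒜 : 𝒜.Nonempty) (hℬ : ℬ.Nonempty) {a l : Lit} (hl : l.1 ≠ y) :
    CanCollapse (extendWith S y 𝒜 ℬ) a l ↔ CanCollapse S a l := by
  obtain ⟨A, hA⟩ := h𝒜
  obtain ⟨B, hB⟩ := hℬ
  constructor
  · rintro ⟨t, ⟨s, hs, -, -, -, -, -, -, ht⟩, hta⟩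
    exact ⟨s, hs, ht l hl ▸ hta⟩
  · rintro ⟨s, hs, hsa⟩
    obtain ⟨t, ht, -, -, htl⟩ := exists_mem_extendWith y hs hA hB
    exact ⟨t, ht, htl l hl ▸ hsa⟩

lemma canCollapse_of_biUnion_subset {S : Set (Lit → Finset Lit)} {s : Lit → Finset Lit}
    (hs : s ∈ S) {A : Clause} {a : Lit} (h : A.biUnion s ⊆ {a}) : ∀ x ∈ A, CanCollapse S a x :=
  fun _ hx => ⟨s, hs, (Finset.subset_biUnion_of_mem s hx).trans h⟩

/-- The ways of replacing a new literal that collapses iff some member of `𝒜` does. -/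
lemma exists_mem_collapse {S : Set (Lit → Finset Lit)} {𝒜 : Set Clause} (h𝒜 : 𝒜.Nonempty)
    {a : Lit} {s : Lit → Finset Lit} (hs : ∀ l, CanCollapse S a l → s l ⊆ {a}) :
    ∃ A ∈ 𝒜, (∃ A' ∈ 𝒜, ∀ x ∈ A', CanCollapse S a x) → A.biUnion s ⊆ {a} := by
  by_cases h : ∃ A' ∈ 𝒜, ∀ x ∈ A', CanCollapse S a x
  · obtain ⟨A, hA, hx⟩ := h
    exact ⟨A, hA, fun _ => Finset.biUnion_subset.2 fun x hxA => hs x (hx x hxA)⟩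
  · obtain ⟨A, hA⟩ := h𝒜
    exact ⟨A, hA, fun h' => absurd h' h⟩

lemma exists_mem_cyclic {S : Set (Lit → Finset Lit)} {𝒜 : Set Clause} (h𝒜 : 𝒜.Nonempty)
    {a b c : Lit} {s : Lit → Finset Lit}
    (hs : ∀ l, (CanCollapse S a l → ¬ CanCollapse S b l → a ∈ s l) ∧
      (CanCollapse S b l → ¬ CanCollapse S c l → b ∈ s l) ∧
      (CanCollapse S c l → ¬ CanCollapse S a l → c ∈ s l))
    {T : Lit → Prop} (hT : ∀ a, T a ↔ ∃ A ∈ 𝒜, ∀ x ∈ A, CanCollapse S a x) :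
    ∃ A ∈ 𝒜, (T a → ¬ T b → a ∈ A.biUnion s) ∧ (T b → ¬ T c → b ∈ A.biUnion s) ∧
      (T c → ¬ T a → c ∈ A.biUnion s) := by
  have key : ∀ {u w : Lit}, (∀ l, CanCollapse S u l → ¬ CanCollapse S w l → u ∈ s l) →
      T u → ¬ T w → ∃ A ∈ 𝒜, u ∈ A.biUnion s := by
    intro u w h hu hw
    obtain ⟨A, hA, hx⟩ := (hT u).1 hu
    have : ∃ x ∈ A, ¬ CanCollapse S w x := by
      by_contra! hc
      exact hw ((hT w).2 ⟨A, hA, hc⟩)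
    obtain ⟨x, hxA, hxw⟩ := this
    exact ⟨A, hA, Finset.mem_biUnion.2 ⟨x, hxA, h x (hx x hxA) hxw⟩⟩
  by_cases h₁ : T a ∧ ¬ T b
  · obtain ⟨A, hA, h⟩ := key (fun l => (hs l).1) h₁.1 h₁.2
    exact ⟨A, hA, by tauto⟩
  by_cases h₂ : T b ∧ ¬ T c
  · obtain ⟨A, hA, h⟩ := key (fun l => (hs l).2.1) h₂.1 h₂.2
    exact ⟨A, hA, by tauto⟩
  by_cases h₃ : T c ∧ ¬ T a
  · obtain ⟨A, hA, h⟩ := key (fun l => (hs l).2.2) h₃.1 h₃.2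
    exact ⟨A, hA, by tauto⟩
  obtain ⟨A, hA⟩ := h𝒜
  exact ⟨A, hA, by tauto⟩

lemma IsRegular.extendWith {S : Set (Lit → Finset Lit)} (hS : IsRegular S) (y : ℕ)
    {𝒜 ℬ : Set Clause} (h𝒜 : 𝒜.Nonempty) (hℬ : ℬ.Nonempty) :
    IsRegular (extendWith S y 𝒜 ℬ) := by
  have hpos : ∀ a, CanCollapse (BVAPaper.extendWith S y 𝒜 ℬ) a (y, true) ↔
      ∃ A ∈ 𝒜, ∀ x ∈ A, CanCollapse S a x := by
    intro a
    constructor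
    · rintro ⟨t, ⟨s, hs, A, hA, -, -, ht, -, -⟩, hta⟩
      exact ⟨A, hA, canCollapse_of_biUnion_subset hs (ht ▸ hta)⟩
    · rintro ⟨A, hA, hx⟩
      obtain ⟨s, hs, hsa⟩ := hS.collapse a
      obtain ⟨B, hB⟩ := hℬ
      obtain ⟨t, ht, htA, -⟩ := exists_mem_extendWith y hs hA hB
      exact ⟨t, ht, htA ▸ Finset.biUnion_subset.2 fun x hxA => hsa x (hx x hxA)⟩
  have hneg : ∀ a, CanCollapse (BVAPaper.extendWith S y 𝒜 ℬ) a (y, false) ↔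
      ∃ B ∈ ℬ, ∀ x ∈ B, CanCollapse S a x := by
    intro a
    constructor
    · rintro ⟨t, ⟨s, hs, -, -, B, hB, -, ht, -⟩, hta⟩
      exact ⟨B, hB, canCollapse_of_biUnion_subset hs (ht ▸ hta)⟩
    · rintro ⟨B, hB, hx⟩
      obtain ⟨s, hs, hsa⟩ := hS.collapse a
      obtain ⟨A, hA⟩ := h𝒜
      obtain ⟨t, ht, -, htB, -⟩ := exists_mem_extendWith y hs hA hB
      exact ⟨t, ht, htB ▸ Finset.biUnion_subset.2 fun x hxB => hsa x (hx x hxB)⟩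
  have hcases : ∀ l : Lit, l = (y, true) ∨ l = (y, false) ∨ l.1 ≠ y := by
    rintro ⟨v, _ | _⟩ <;> by_cases h : v = y <;> simp [h]
  constructor
  · intro a
    obtain ⟨s, hs, hsa⟩ := hS.collapse a
    obtain ⟨A, hA, hAa⟩ := exists_mem_collapse h𝒜 hsa
    obtain ⟨B, hB, hBa⟩ := exists_mem_collapse hℬ hsa
    obtain ⟨t, ht, htA, htB, htl⟩ := exists_mem_extendWith y hs hA hB
    refine ⟨t, ht, fun l hl => ?_⟩
    rcases hcases l with rfl | rfl | h
    · exact htA ▸ hAa ((hpos a).1 hl)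
    · exact htB ▸ hBa ((hneg a).1 hl)
    · exact htl l h ▸ hsa l ((canCollapse_extendWith_iff h𝒜 hℬ h).1 hl)
  · intro a b c
    obtain ⟨s, hs, hsc⟩ := hS.cyclic a b c
    obtain ⟨A, hA, hAc⟩ := exists_mem_cyclic h𝒜 hsc hpos
    obtain ⟨B, hB, hBc⟩ := exists_mem_cyclic hℬ hsc hneg
    obtain ⟨t, ht, htA, htB, htl⟩ := exists_mem_extendWith y hs hA hB
    refine ⟨t, ht, fun l => ?_⟩
    rcases hcases l with rfl | rfl | h
    · rw [htA]; exact hAc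
    · rw [htB]; exact hBc
    · rw [htl l h]
      simp only [canCollapse_extendWith_iff h𝒜 hℬ h]
      exact hsc l

lemma mem_Vars_iff {φ : Formula} {v : ℕ} : v ∈ Vars φ ↔ ∃ C ∈ φ, ∃ l ∈ C, l.1 = v := by
  simp only [Vars, Finset.mem_biUnion, Finset.mem_image]

lemma mem_JoinClauses_iff {𝒞 𝒟 : Finset Clause} {F : Clause} :
    F ∈ JoinClauses 𝒞 𝒟 ↔ ∃ C ∈ 𝒞, ∃ D ∈ 𝒟, C ∪ D = F := by
  simp only [JoinClauses, Finset.mem_image, Finset.mem_product, Prod.exists]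
  aesop

/-- The result of a BVA step on `φ` with respect to `𝒞`, `𝒟` and the new variable `y`. -/
def bvaResult (φ : Formula) (𝒞 𝒟 : Finset Clause) (y : ℕ) : Formula :=
  (φ \ JoinClauses 𝒞 𝒟)
    ∪ 𝒞.image (fun C => insert ((y, true) : Lit) C)
    ∪ 𝒟.image (fun D => insert ((y, false) : Lit) D)

lemma mem_bvaResult_iff {φ : Formula} {𝒞 𝒟 : Finset Clause} {y : ℕ} {F : Clause} :
    F ∈ bvaResult φ 𝒞 𝒟 y ↔ (F ∈ φ ∧ F ∉ JoinClauses 𝒞 𝒟) ∨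
      (∃ C ∈ 𝒞, insert (y, true) C = F) ∨ ∃ D ∈ 𝒟, insert (y, false) D = F := by
  simp only [bvaResult, Finset.mem_union, Finset.mem_sdiff, Finset.mem_image, or_assoc]

/-- A BVA step with nonempty `𝒞` and `𝒟`. -/
def ProperStep (φ φ' : Formula) : Prop :=
  ∃ (𝒞 𝒟 : Finset Clause) (y : ℕ), 𝒞.Nonempty ∧ 𝒟.Nonempty ∧ JoinClauses 𝒞 𝒟 ⊆ φ ∧
    y ∉ Vars φ ∧ φ' = bvaResult φ 𝒞 𝒟 y

/-- A BVA step acts on the clauses avoiding a suitable set of literals as a proper step or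
not at all. -/
lemma BVAStep.exists_avoiding {φ φ' : Formula} (h : BVAStep φ φ') (M : Finset Lit) :
    ∃ M' : Finset Lit, Relation.ReflTransGen ProperStep (φ.filter (Disjoint · M))
      (φ'.filter (Disjoint · M')) := by
  obtain ⟨𝒞, 𝒟, y, -, -, hsub, hy, hφ'⟩ := h
  change φ' = bvaResult φ 𝒞 𝒟 y at hφ'
  have hyF : ∀ F ∈ φ, ∀ l ∈ F, l.1 ≠ y := fun F hF l hl hly =>
    hy (mem_Vars_iff.2 ⟨F, hF, l, hl, hly⟩)
  set M₀ : Finset Lit := M.filter (fun l => l.1 ≠ y) with hM₀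
  have hM₀y : ∀ l ∈ M₀, l.1 ≠ y := fun l hl => (Finset.mem_filter.1 hl).2
  have hfilter : φ.filter (Disjoint · M) = φ.filter (Disjoint · M₀) := by
    refine Finset.filter_congr fun F hF => ?_
    simp only [Finset.disjoint_left, hM₀, Finset.mem_filter]
    exact ⟨fun h l hl hlM => h hl hlM.1, fun h l hl hlM => h hl ⟨hlM, hyF F hF l hl⟩⟩
  rw [hfilter]
  have hins : ∀ (b : Bool) (C : Clause), Disjoint (insert (y, b) C) M₀ ↔ Disjoint C M₀ := by
    intro b C
    rw [Finset.disjoint_insert_left]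
    exact ⟨fun h => h.2, fun h => ⟨fun hm => hM₀y _ hm rfl, h⟩⟩
  have hmark : ∀ (b : Bool) (F : Clause),
      Disjoint F (insert (y, b) M₀) ↔ (y, b) ∉ F ∧ Disjoint F M₀ := fun b F =>
    Finset.disjoint_insert_right
  have hyF' : ∀ F ∈ φ, ∀ b, (y, b) ∉ F := fun F hF b hl => hyF F hF _ hl rfl
  by_cases h𝒟 : ∃ D ∈ 𝒟, Disjoint D M₀
  · by_cases h𝒞 : ∃ C ∈ 𝒞, Disjoint C M₀
    · refine ⟨M₀, Relation.ReflTransGen.single ⟨𝒞.filter (Disjoint · M₀),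
        𝒟.filter (Disjoint · M₀), y, ?_, ?_, ?_, ?_, ?_⟩⟩
      · obtain ⟨C, hC, hCM⟩ := h𝒞
        exact ⟨C, Finset.mem_filter.2 ⟨hC, hCM⟩⟩
      · obtain ⟨D, hD, hDM⟩ := h𝒟
        exact ⟨D, Finset.mem_filter.2 ⟨hD, hDM⟩⟩
      · intro F hF
        obtain ⟨C, hC, D, hD, rfl⟩ := mem_JoinClauses_iff.1 hF
        obtain ⟨hC, hCM⟩ := Finset.mem_filter.1 hC
        obtain ⟨hD, hDM⟩ := Finset.mem_filter.1 hD
        exact Finset.mem_filter.2 ⟨hsub (mem_JoinClauses_iff.2 ⟨C, hC, D, hD, rfl⟩),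
          Finset.disjoint_union_left.2 ⟨hCM, hDM⟩⟩
      · intro h
        obtain ⟨F, hF, l, hl, hly⟩ := mem_Vars_iff.1 h
        exact hyF F (Finset.mem_filter.1 hF).1 l hl hly
      · ext F
        rw [Finset.mem_filter, hφ', mem_bvaResult_iff, mem_bvaResult_iff]
        simp only [Finset.mem_filter, mem_JoinClauses_iff]
        constructor
        · rintro ⟨⟨hF, hJ⟩ | ⟨C, hC, rfl⟩ | ⟨D, hD, rfl⟩, hM⟩
          · exact Or.inl ⟨⟨hF, hM⟩, fun ⟨C, hC, D, hD, h⟩ => hJ ⟨C, hC.1, D, hD.1, h⟩⟩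
          · exact Or.inr (Or.inl ⟨C, ⟨hC, (hins _ _).1 hM⟩, rfl⟩)
          · exact Or.inr (Or.inr ⟨D, ⟨hD, (hins _ _).1 hM⟩, rfl⟩)
        · rintro (⟨⟨hF, hM⟩, hJ⟩ | ⟨C, ⟨hC, hM⟩, rfl⟩ | ⟨D, ⟨hD, hM⟩, rfl⟩)
          · refine ⟨Or.inl ⟨hF, ?_⟩, hM⟩
            rintro ⟨C, hC, D, hD, rfl⟩
            obtain ⟨hCM, hDM⟩ := Finset.disjoint_union_left.1 hM
            exact hJ ⟨C, ⟨hC, hCM⟩, D, ⟨hD, hDM⟩, rfl⟩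
          · exact ⟨Or.inr (Or.inl ⟨C, hC, rfl⟩), (hins _ _).2 hM⟩
          · exact ⟨Or.inr (Or.inr ⟨D, hD, rfl⟩), (hins _ _).2 hM⟩
    · push Not at h𝒞
      refine ⟨insert (y, false) M₀, ?_⟩
      suffices h : φ'.filter (Disjoint · (insert (y, false) M₀)) = φ.filter (Disjoint · M₀) by
        rw [h]
      ext F
      rw [Finset.mem_filter, Finset.mem_filter, hφ', mem_bvaResult_iff, hmark]
      constructor
      · rintro ⟨⟨hF, -⟩ | ⟨C, hC, rfl⟩ | ⟨D, -, rfl⟩, hy', hM⟩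
        · exact ⟨hF, hM⟩
        · exact absurd ((hins _ _).1 hM) (h𝒞 C hC)
        · exact absurd (Finset.mem_insert_self _ _) hy'
      · rintro ⟨hF, hM⟩
        refine ⟨Or.inl ⟨hF, fun hJ => ?_⟩, hyF' F hF _, hM⟩
        obtain ⟨C, hC, D, -, rfl⟩ := mem_JoinClauses_iff.1 hJ
        exact h𝒞 C hC (Finset.disjoint_union_left.1 hM).1
  · push Not at h𝒟
    refine ⟨insert (y, true) M₀, ?_⟩
    suffices h : φ'.filter (Disjoint · (insert (y, true) M₀)) = φ.filter (Disjoint · M₀) by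
      rw [h]
    ext F
    rw [Finset.mem_filter, Finset.mem_filter, hφ', mem_bvaResult_iff, hmark]
    constructor
    · rintro ⟨⟨hF, -⟩ | ⟨C, -, rfl⟩ | ⟨D, hD, rfl⟩, hy', hM⟩
      · exact ⟨hF, hM⟩
      · exact absurd (Finset.mem_insert_self _ _) hy'
      · exact absurd ((hins _ _).1 hM) (h𝒟 D hD)
    · rintro ⟨hF, hM⟩
      refine ⟨Or.inl ⟨hF, fun hJ => ?_⟩, hyF' F hF _, hM⟩
      obtain ⟨C, -, D, hD, rfl⟩ := mem_JoinClauses_iff.1 hJ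
      exact h𝒟 D hD (Finset.disjoint_union_left.1 hM).2

/-- Every BVA chain contains, on a subset of its final formula, a chain of proper steps. -/
lemma BVAChain.exists_proper {φ φ' : Formula} (h : BVAChain φ φ') :
    ∃ φ'' ⊆ φ', Relation.ReflTransGen ProperStep φ φ'' := by
  suffices ∃ M : Finset Lit, Relation.ReflTransGen ProperStep φ (φ'.filter (Disjoint · M)) by
    obtain ⟨M, hM⟩ := this
    exact ⟨_, Finset.filter_subset _ _, hM⟩
  induction h with
  | refl => exact ⟨∅, by simpa using Relation.ReflTransGen.refl⟩
  | tail _ hstep ih =>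
    obtain ⟨M, hM⟩ := ih
    obtain ⟨M', hM'⟩ := BVAStep.exists_avoiding hstep M
    exact ⟨M', hM.trans hM'⟩

/-- A truth assignment to literals is complementary off `X` if literals of the same variable
outside `X` get opposite values. -/
def ComplementaryOff (X : Finset ℕ) (v : Lit → Prop) : Prop :=
  ∀ y ∉ X, (v (y, true) ↔ ¬ v (y, false))

/-- The literals over `X` that are false under `v` are those in `E`. -/
def FalseExactlyOn (X : Finset ℕ) (E : Clause) (v : Lit → Prop) : Prop :=
  ∀ l : Lit, l.1 ∈ X → (v l ↔ l ∉ E)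

/-- `φ` expands to the 2-CNF formula `φ₀` with variables `X` by means of the expansions in `S`,
and both are related semantically. -/
structure Expands (X : Finset ℕ) (φ₀ φ : Formula) (S : Set (Lit → Finset Lit)) : Prop where
  regular : IsRegular S
  mem : ∀ F ∈ φ, ∀ s ∈ S, F.biUnion s ∈ φ₀
  vars : X ⊆ Vars φ
  refute : ∀ E : Clause, E.card = 2 → E ∉ φ₀ → (∀ l ∈ E, l.1 ∈ X) →
    ∃ v : Lit → Prop, ComplementaryOff X v ∧
    FalseExactlyOn X E v ∧ ∀ F ∈ φ, ∀ G ⊆ F, G.card ≤ 2 → IsSound S G → ∃ l ∈ G, v l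
  sat : ∀ v : Lit → Prop, ComplementaryOff X v → (∀ F ∈ φ, ∃ l ∈ F, v l) →
    ∀ F ∈ φ₀, ∃ l ∈ F, v l

lemma isRegular_singleton : IsRegular {fun l : Lit => ({l} : Finset Lit)} where
  collapse a := ⟨_, rfl, fun l hl => by
    obtain ⟨_, rfl, h⟩ := hl
    exact h⟩
  cyclic a b c := by
    have h : ∀ {a l : Lit}, CanCollapse {fun l : Lit => ({l} : Finset Lit)} a l →
        a ∈ ({l} : Finset Lit) := by
      rintro a l ⟨_, rfl, h⟩
      simpa [eq_comm] using h
    exact ⟨_, rfl, fun l => ⟨fun hl _ => h hl, fun hl _ => h hl, fun hl _ => h hl⟩⟩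

lemma expands_self {φ₀ : Formula} (h : ∀ E ∈ φ₀, E.card = 2) :
    Expands (Vars φ₀) φ₀ φ₀ {fun l : Lit => ({l} : Finset Lit)} where
  regular := isRegular_singleton
  mem := by
    rintro F hF _ rfl
    simpa using hF
  vars := subset_rfl
  refute := by
    intro E hE hEφ _
    refine ⟨fun l => if l.1 ∈ Vars φ₀ then l ∉ E else l.2 = true, ?_, ?_, ?_⟩
    · intro y hy
      simp [hy]
    · intro l hl
      simp [hl]
    · intro F hF G hG _ hs
      have h2 : 2 ≤ G.card := by simpa using hs _ rfl
      obtain rfl : G = F := Finset.eq_of_subset_of_card_le hG ((h F hF).trans_le h2)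
      have : ¬ G ⊆ E := fun hGE => hEφ
        (Finset.eq_of_subset_of_card_le hGE (hE.trans_le h2) ▸ hF)
      obtain ⟨l, hl, hlE⟩ := Finset.not_subset.1 this
      exact ⟨l, hl, by simpa [mem_Vars_iff.2 ⟨G, hF, l, hl, rfl⟩] using hlE⟩
  sat := fun v _ hv => hv

lemma biUnion_eq_of_fresh {y : ℕ} {s t : Lit → Finset Lit} (ht : ∀ l : Lit, l.1 ≠ y → t l = s l)
    {G : Clause} (hG : ∀ l ∈ G, l.1 ≠ y) : G.biUnion t = G.biUnion s :=
  Finset.biUnion_congr rfl fun l hl => ht l (hG l hl)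

lemma IsSound.of_extendWith {S : Set (Lit → Finset Lit)} {y : ℕ} {𝒜 ℬ : Set Clause}
    (h𝒜 : 𝒜.Nonempty) (hℬ : ℬ.Nonempty) {G : Clause} (hG : ∀ l ∈ G, l.1 ≠ y)
    (h : IsSound (extendWith S y 𝒜 ℬ) G) : IsSound S G := by
  intro s hs
  obtain ⟨A, hA⟩ := h𝒜
  obtain ⟨B, hB⟩ := hℬ
  obtain ⟨t, ht, -, -, htl⟩ := exists_mem_extendWith y hs hA hB
  exact biUnion_eq_of_fresh htl hG ▸ h t ht

lemma IsSound.of_extendWith_pos {S : Set (Lit → Finset Lit)} {y : ℕ} {𝒜 ℬ : Set Clause}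
    (hℬ : ℬ.Nonempty) {G : Clause} (hG : ∀ l ∈ G, l.1 ≠ y)
    (h : IsSound (extendWith S y 𝒜 ℬ) (insert (y, true) G)) {A : Clause} (hA : A ∈ 𝒜) :
    IsSound S (G ∪ A) := by
  intro s hs
  obtain ⟨B, hB⟩ := hℬ
  obtain ⟨t, ht, htA, -, htl⟩ := exists_mem_extendWith y hs hA hB
  have := h t ht
  rwa [Finset.biUnion_insert, htA, biUnion_eq_of_fresh htl hG, ← Finset.union_biUnion,
    Finset.union_comm] at this

lemma IsSound.of_extendWith_neg {S : Set (Lit → Finset Lit)} {y : ℕ} {𝒜 ℬ : Set Clause}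
    (h𝒜 : 𝒜.Nonempty) {G : Clause} (hG : ∀ l ∈ G, l.1 ≠ y)
    (h : IsSound (extendWith S y 𝒜 ℬ) (insert (y, false) G)) {B : Clause} (hB : B ∈ ℬ) :
    IsSound S (G ∪ B) := by
  intro s hs
  obtain ⟨A, hA⟩ := h𝒜
  obtain ⟨t, ht, -, htB, htl⟩ := exists_mem_extendWith y hs hA hB
  have := h t ht
  rwa [Finset.biUnion_insert, htB, biUnion_eq_of_fresh htl hG, ← Finset.union_biUnion,
    Finset.union_comm] at this

lemma ComplementaryOff.exists_of_bvaResult {X : Finset ℕ} {v : Lit → Prop}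
    (hv : ComplementaryOff X v) {φ : Formula} {𝒞 𝒟 : Finset Clause} {y : ℕ} (hy : y ∉ X)
    (h : ∀ F ∈ bvaResult φ 𝒞 𝒟 y, ∃ l ∈ F, v l) : ∀ F ∈ φ, ∃ l ∈ F, v l := by
  intro F hF
  by_cases hJ : F ∈ JoinClauses 𝒞 𝒟
  · obtain ⟨C, hC, D, hD, rfl⟩ := mem_JoinClauses_iff.1 hJ
    obtain ⟨l, hl, hvl⟩ := h _ (mem_bvaResult_iff.2 (Or.inr (Or.inl ⟨C, hC, rfl⟩)))
    obtain ⟨k, hk, hvk⟩ := h _ (mem_bvaResult_iff.2 (Or.inr (Or.inr ⟨D, hD, rfl⟩)))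
    rcases Finset.mem_insert.1 hl with rfl | hl
    · rcases Finset.mem_insert.1 hk with rfl | hk
      · exact absurd hvk ((hv y hy).1 hvl)
      · exact ⟨k, Finset.mem_union_right _ hk, hvk⟩
    · exact ⟨l, Finset.mem_union_left _ hl, hvl⟩
  · exact h F (mem_bvaResult_iff.2 (Or.inl ⟨hF, hJ⟩))

lemma subset_Vars_bvaResult {φ : Formula} {𝒞 𝒟 : Finset Clause} {y : ℕ} :
    Vars φ ⊆ Vars (bvaResult φ 𝒞 𝒟 y) := by
  intro x hx
  obtain ⟨F, hF, l, hl, rfl⟩ := mem_Vars_iff.1 hx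
  rw [mem_Vars_iff]
  by_cases hJ : F ∈ JoinClauses 𝒞 𝒟
  · obtain ⟨C, hC, D, hD, rfl⟩ := mem_JoinClauses_iff.1 hJ
    rcases Finset.mem_union.1 hl with hl | hl
    · exact ⟨_, mem_bvaResult_iff.2 (Or.inr (Or.inl ⟨C, hC, rfl⟩)), l,
        Finset.mem_insert_of_mem hl, rfl⟩
    · exact ⟨_, mem_bvaResult_iff.2 (Or.inr (Or.inr ⟨D, hD, rfl⟩)), l,
        Finset.mem_insert_of_mem hl, rfl⟩
  · exact ⟨F, mem_bvaResult_iff.2 (Or.inl ⟨hF, hJ⟩), l, hl, rfl⟩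

lemma Expands.step {X : Finset ℕ} {φ₀ φ φ' : Formula} {S : Set (Lit → Finset Lit)}
    (hφ₀ : ∀ E ∈ φ₀, E.card = 2) (h : Expands X φ₀ φ S) (hstep : ProperStep φ φ') :
    ∃ S', Expands X φ₀ φ' S' := by
  obtain ⟨𝒞, 𝒟, y, h𝒞, h𝒟, hsub, hy, rfl⟩ := hstep
  have hjoin : ∀ C ∈ 𝒞, ∀ D ∈ 𝒟, C ∪ D ∈ φ := fun C hC D hD =>
    hsub (mem_JoinClauses_iff.2 ⟨C, hC, D, hD, rfl⟩)
  have hyX : y ∉ X := fun hX => hy (h.vars hX)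
  have hyF : ∀ F ∈ φ, ∀ l ∈ F, l.1 ≠ y := fun F hF l hl hly =>
    hy (mem_Vars_iff.2 ⟨F, hF, l, hl, hly⟩)
  have hyC : ∀ C ∈ 𝒞, ∀ l ∈ C, l.1 ≠ y := by
    intro C hC l hl
    obtain ⟨D, hD⟩ := h𝒟
    exact hyF _ (hjoin C hC D hD) l (Finset.mem_union_left _ hl)
  have hyD : ∀ D ∈ 𝒟, ∀ l ∈ D, l.1 ≠ y := by
    intro D hD l hl
    obtain ⟨C, hC⟩ := h𝒞
    exact hyF _ (hjoin C hC D hD) l (Finset.mem_union_right _ hl)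
  obtain ⟨𝒜, ℬ, h𝒜, hℬ, hA, hB, hres⟩ := h.regular.exists_substitutes hφ₀ h𝒞 h𝒟
    fun C hC D hD => h.mem _ (hjoin C hC D hD)
  refine ⟨extendWith S y 𝒜 ℬ, h.regular.extendWith y h𝒜 hℬ, ?_,
    h.vars.trans subset_Vars_bvaResult, ?_,
    fun v hv hsat => h.sat v hv (hv.exists_of_bvaResult hyX hsat)⟩
  · rintro F hF t ⟨s, hs, A, hA', B, hB', htA, htB, ht⟩
    rcases mem_bvaResult_iff.1 hF with ⟨hF, -⟩ | ⟨C, hC, rfl⟩ | ⟨D, hD, rfl⟩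
    · exact biUnion_eq_of_fresh ht (hyF F hF) ▸ h.mem F hF s hs
    · rw [Finset.biUnion_insert, htA, biUnion_eq_of_fresh ht (hyC C hC), ← Finset.union_biUnion,
        Finset.union_comm]
      exact hA C hC A hA' s hs
    · rw [Finset.biUnion_insert, htB, biUnion_eq_of_fresh ht (hyD D hD), ← Finset.union_biUnion,
        Finset.union_comm]
      exact hB D hD B hB' s hs
  intro E hE hEφ hEX
  obtain ⟨v, hvX, hvE, hv⟩ := h.refute E hE hEφ hEX
  let P : Prop := ∃ C ∈ 𝒞, ∃ G ⊆ C, G.card ≤ 1 ∧ (∀ A ∈ 𝒜, IsSound S (G ∪ A)) ∧ ∀ l ∈ G, ¬ v l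
  obtain ⟨w, hwt, hwf, hw⟩ : ∃ w : Lit → Prop, (w (y, true) ↔ P) ∧ (w (y, false) ↔ ¬ P) ∧
      ∀ l : Lit, l.1 ≠ y → (w l ↔ v l) := by
    refine ⟨fun l => if l.1 = y then (if l.2 then P else ¬ P) else v l, by simp, by simp, ?_⟩
    intro l hl
    simp [hl]
  refine ⟨w, ?_, ?_, ?_⟩
  · intro x hx
    by_cases hxy : x = y
    · subst hxy
      rw [hwt, hwf, not_not]
    · rw [hw _ hxy, hw _ hxy]
      exact hvX x hx
  · intro l hl
    rw [hw l fun hly => hyX (hly ▸ hl)]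
    exact hvE l hl
  have hold : ∀ F ∈ φ, ∀ G ⊆ F, G.card ≤ 2 → IsSound (extendWith S y 𝒜 ℬ) G →
      ∃ l ∈ G, w l := by
    intro F hF G hG hc hs
    have hyG : ∀ l ∈ G, l.1 ≠ y := fun l hl => hyF F hF l (hG hl)
    obtain ⟨l, hl, hvl⟩ := hv F hF G hG hc (hs.of_extendWith h𝒜 hℬ hyG)
    exact ⟨l, hl, (hw l (hyG l hl)).2 hvl⟩
  intro F hF G hG hc hs
  rcases mem_bvaResult_iff.1 hF with ⟨hF, -⟩ | ⟨C, hC, rfl⟩ | ⟨D, hD, rfl⟩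
  · exact hold F hF G hG hc hs
  · by_cases hyG : (y, true) ∈ G
    · have hGe : G.erase (y, true) ⊆ C := Finset.subset_insert_iff.1 hG
      have hGy : ∀ l ∈ G.erase (y, true), l.1 ≠ y := fun l hl => hyC C hC l (hGe hl)
      by_cases hP : P
      · exact ⟨_, hyG, hwt.2 hP⟩
      · have hs' := Finset.insert_erase hyG ▸ hs
        have : ¬ ∀ l ∈ G.erase (y, true), ¬ v l := fun hvG => hP ⟨C, hC, _, hGe, by
          rw [Finset.card_erase_of_mem hyG]; omega, fun A hA =>
            hs'.of_extendWith_pos hℬ hGy hA, hvG⟩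
        push Not at this
        obtain ⟨l, hl, hvl⟩ := this
        exact ⟨l, Finset.mem_of_mem_erase hl, (hw l (hGy l hl)).2 hvl⟩
    · obtain ⟨D, hD⟩ := h𝒟
      exact hold _ (hjoin C hC D hD) G
        (((Finset.subset_insert_iff_of_notMem hyG).1 hG).trans Finset.subset_union_left) hc hs
  · by_cases hyG : (y, false) ∈ G
    · have hGe : G.erase (y, false) ⊆ D := Finset.subset_insert_iff.1 hG
      have hGy : ∀ l ∈ G.erase (y, false), l.1 ≠ y := fun l hl => hyD D hD l (hGe hl)
      by_cases hP : P
      · obtain ⟨C, hC, H, hH, hHc, hHs, hHv⟩ := hP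
        have hs' := Finset.insert_erase hyG ▸ hs
        have hsound := hres C hC D hD H hH _ hGe hHs
          fun B hB => hs'.of_extendWith_neg h𝒜 hGy hB
        obtain ⟨l, hl, hvl⟩ := hv _ (hjoin C hC D hD) _ (Finset.union_subset_union hH hGe)
          ((Finset.card_union_le _ _).trans (by rw [Finset.card_erase_of_mem hyG]; omega)) hsound
        rcases Finset.mem_union.1 hl with hl | hl
        · exact absurd hvl (hHv l hl)
        · exact ⟨l, Finset.mem_of_mem_erase hl, (hw l (hGy l hl)).2 hvl⟩
      · exact ⟨_, hyG, hwf.2 hP⟩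
    · obtain ⟨C, hC⟩ := h𝒞
      exact hold _ (hjoin C hC D hD) G
        (((Finset.subset_insert_iff_of_notMem hyG).1 hG).trans Finset.subset_union_right) hc hs

/-- A 2-CNF formula can be read off from a set of pairs of literals that is at most as large as
any formula obtained from it by BVA. -/
lemma BVAChain.exists_pairs {φ₀ φ : Formula} (hφ₀ : ∀ E ∈ φ₀, E.card = 2) (h : BVAChain φ₀ φ) :
    ∃ ψ : Finset (Lit × Lit), ψ.card ≤ φ.card ∧
      ∀ E : Clause, E.card = 2 → (∀ l ∈ E, l.1 ∈ Vars φ₀) →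
        (E ∉ φ₀ ↔ ∃ v : Lit → Prop, ComplementaryOff (Vars φ₀) v ∧
          FalseExactlyOn (Vars φ₀) E v ∧ ∀ e ∈ ψ, v e.1 ∨ v e.2) := by
  obtain ⟨φ', hφ', hchain⟩ := BVAChain.exists_proper h
  obtain ⟨S, hS⟩ : ∃ S, Expands (Vars φ₀) φ₀ φ' S := by
    clear hφ' h
    induction hchain with
    | refl => exact ⟨_, expands_self hφ₀⟩
    | tail _ hstep ih =>
      obtain ⟨S, hS⟩ := ih
      exact hS.step hφ₀ hstep
  have hpair : ∀ F ∈ φ', ∃ p : Lit × Lit, {p.1, p.2} ⊆ F ∧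
      IsSound S ({p.1, p.2} : Finset Lit) := by
    intro F hF
    obtain ⟨G, hG, hc, hs⟩ := hS.regular.exists_small_isSound
      fun s hs => hφ₀ _ (hS.mem F hF s hs)
    obtain ⟨s, hsS, -⟩ := hS.regular.collapse (0, true)
    have hne : 0 < G.card := by
      by_contra h0
      obtain rfl : G = ∅ := by simpa using h0
      simpa using hs s hsS
    rcases (by omega : G.card = 1 ∨ G.card = 2) with h1 | h2
    · obtain ⟨a, rfl⟩ := Finset.card_eq_one.1 h1
      exact ⟨(a, a), by simpa using hG, by simpa using hs⟩
    · obtain ⟨a, b, -, rfl⟩ := Finset.card_eq_two.1 h2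
      exact ⟨(a, b), hG, hs⟩
  choose! p hpF hps using hpair
  refine ⟨φ'.image p, Finset.card_image_le.trans (Finset.card_le_card hφ'), ?_⟩
  intro E hE hEX
  constructor
  · intro hEφ
    obtain ⟨v, hvX, hvE, hv⟩ := hS.refute E hE hEφ hEX
    refine ⟨v, hvX, hvE, fun e he => ?_⟩
    obtain ⟨F, hF, rfl⟩ := Finset.mem_image.1 he
    obtain ⟨l, hl, hvl⟩ := hv F hF _ (hpF F hF) Finset.card_le_two (hps F hF)
    rcases Finset.mem_insert.1 hl with rfl | hl
    · exact Or.inl hvl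
    · exact Or.inr (Finset.mem_singleton.1 hl ▸ hvl)
  · rintro ⟨v, hvX, hvE, hv⟩ hEφ
    obtain ⟨l, hl, hvl⟩ := hS.sat v hvX (fun F hF => by
      rcases hv _ (Finset.mem_image_of_mem p hF) with h1 | h1
      · exact ⟨_, hpF F hF (by simp), h1⟩
      · exact ⟨_, hpF F hF (by simp), h1⟩) E hEφ
    exact (hvE l (hEX l hl)).1 hvl hl

/-- The set of literals over the variables `0, …, m - 1`. -/
def lits (m : ℕ) : Finset Lit := Finset.range m ×ˢ Finset.univ

lemma mem_lits {m : ℕ} {l : Lit} : l ∈ lits m ↔ l.1 < m := by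
  simp [lits]

lemma card_lits (m : ℕ) : (lits m).card = 2 * m := by
  simp [lits, Finset.card_product, mul_comm]

lemma exists_compression (n : ℕ) (A : Finset ℕ) (hA : ∀ a ∈ A, n ≤ a) :
    ∃ f g : ℕ → ℕ, (∀ x < n, f x = x) ∧ (∀ x < n, g x = x) ∧ (∀ x, n ≤ x → n ≤ f x) ∧
      (∀ x, n ≤ x → n ≤ g x) ∧ ∀ a ∈ A, f a < n + A.card ∧ g (f a) = a := by
  classical
  let f : ℕ → ℕ := fun x => if x < n then x else n + (A.filter (· < x)).card
  have hf : ∀ x, n ≤ x → f x = n + (A.filter (· < x)).card := fun x hx => if_neg hx.not_gt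
  have hlt : ∀ a ∈ A, ∀ x, a < x → (A.filter (· < a)).card < (A.filter (· < x)).card := by
    intro a ha x hx
    refine Finset.card_lt_card ⟨fun b hb => ?_, fun h => ?_⟩
    · simp only [Finset.mem_filter] at hb ⊢
      exact ⟨hb.1, hb.2.trans hx⟩
    · simpa using h (Finset.mem_filter.2 ⟨ha, hx⟩)
  have hinj : ∀ a ∈ A, ∀ b ∈ A, f a = f b → a = b := by
    intro a ha b hb h
    rw [hf a (hA a ha), hf b (hA b hb)] at h
    rcases lt_trichotomy a b with hab | hab | hab
    · have := hlt a ha b hab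
      omega
    · exact hab
    · have := hlt b hb a hab
      omega
  let g : ℕ → ℕ := fun x => if h : ∃ a ∈ A, f a = x then h.choose else x
  have hg : ∀ x, (g x ∈ A ∧ f (g x) = x) ∨ ((¬ ∃ a ∈ A, f a = x) ∧ g x = x) := by
    intro x
    by_cases h : ∃ a ∈ A, f a = x
    · left
      simpa only [g, dif_pos h] using h.choose_spec
    · exact Or.inr ⟨h, dif_neg h⟩
  refine ⟨f, g, fun x hx => if_pos hx, fun x hx => ?_, fun x hx => ?_, fun x hx => ?_,
    fun a ha => ⟨?_, ?_⟩⟩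
  · rcases hg x with ⟨h1, h2⟩ | ⟨-, h2⟩
    · rw [hf _ (hA _ h1)] at h2
      omega
    · exact h2
  · rw [hf x hx]
    omega
  · rcases hg x with ⟨h1, h2⟩ | ⟨-, h2⟩
    · exact hA _ h1
    · exact h2.symm ▸ hx
  · rw [hf a (hA a ha)]
    refine Nat.add_lt_add_left (Finset.card_lt_card ⟨Finset.filter_subset _ _, fun h => ?_⟩) n
    simpa using h ha
  · rcases hg (f a) with ⟨h1, h2⟩ | ⟨h1, -⟩
    · exact hinj _ h1 _ ha h2
    · exact absurd ⟨a, ha, rfl⟩ h1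

/-- The set of pairs in `BVAChain.exists_pairs` can be chosen over few variables. -/
lemma BVAChain.exists_compressed_pairs {n M : ℕ} {φ₀ φ : Formula} (hφ₀ : ∀ E ∈ φ₀, E.card = 2)
    (hvars : Vars φ₀ = Finset.range n) (h : BVAChain φ₀ φ) (hM : φ.card ≤ M) :
    ∃ ψ ⊆ lits (n + 2 * M) ×ˢ lits (n + 2 * M), ψ.card ≤ M ∧
      ∀ E : Clause, E.card = 2 → (∀ l ∈ E, l.1 < n) →
        (E ∉ φ₀ ↔ ∃ v : Lit → Prop, ComplementaryOff (Finset.range n) v ∧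
          FalseExactlyOn (Finset.range n) E v ∧ ∀ e ∈ ψ, v e.1 ∨ v e.2) := by
  classical
  obtain ⟨ψ, hψc, hψ⟩ := h.exists_pairs hφ₀
  rw [hvars] at hψ
  let A : Finset ℕ := ((ψ.image fun e => e.1.1) ∪ ψ.image fun e => e.2.1).filter (n ≤ ·)
  have hAc : A.card ≤ 2 * M := by
    have h1 : (ψ.image fun e => e.1.1).card ≤ ψ.card := Finset.card_image_le
    have h2 : (ψ.image fun e => e.2.1).card ≤ ψ.card := Finset.card_image_le
    calc A.card ≤ _ := Finset.card_filter_le _ _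
      _ ≤ _ := Finset.card_union_le _ _
      _ ≤ 2 * M := by omega
  obtain ⟨f, g, hf, hg, hf', hg', hfg⟩ := exists_compression n A
    fun a ha => (Finset.mem_filter.1 ha).2
  have hmem : ∀ e ∈ ψ, (n ≤ e.1.1 → e.1.1 ∈ A) ∧ (n ≤ e.2.1 → e.2.1 ∈ A) := fun e he =>
    ⟨fun hn => Finset.mem_filter.2
      ⟨Finset.mem_union_left _ (Finset.mem_image_of_mem (fun e : Lit × Lit => e.1.1) he), hn⟩,
    fun hn => Finset.mem_filter.2
      ⟨Finset.mem_union_right _ (Finset.mem_image_of_mem (fun e : Lit × Lit => e.2.1) he), hn⟩⟩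
  have hx : ∀ x, (n ≤ x → x ∈ A) → f x < n + 2 * M ∧ g (f x) = x := by
    intro x hxA
    rcases lt_or_ge x n with hx | hx
    · rw [hf x hx]
      exact ⟨by omega, hg x hx⟩
    · obtain ⟨h1, h2⟩ := hfg x (hxA hx)
      exact ⟨by omega, h2⟩
  have htransfer : ∀ (r : ℕ → ℕ), (∀ x < n, r x = x) → (∀ x, n ≤ x → n ≤ r x) →
      ∀ (E : Clause) (v : Lit → Prop), ComplementaryOff (Finset.range n) v →
      FalseExactlyOn (Finset.range n) E v →
      ComplementaryOff (Finset.range n) (fun l => v (r l.1, l.2)) ∧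
      FalseExactlyOn (Finset.range n) E (fun l => v (r l.1, l.2)) := by
    intro r hr hr' E v hv hE
    constructor
    · intro y hy
      exact hv (r y) (by simpa using hr' y (by simpa using hy))
    · intro l hl
      simp only [hr l.1 (Finset.mem_range.1 hl)]
      exact hE l hl
  refine ⟨ψ.image fun e => ((f e.1.1, e.1.2), (f e.2.1, e.2.2)), ?_,
    Finset.card_image_le.trans (hψc.trans hM), ?_⟩
  · intro e he
    obtain ⟨e, heψ, rfl⟩ := Finset.mem_image.1 he
    exact Finset.mem_product.2 ⟨mem_lits.2 (hx _ (hmem e heψ).1).1,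
      mem_lits.2 (hx _ (hmem e heψ).2).1⟩
  intro E hE hEn
  rw [hψ E hE fun l hl => Finset.mem_range.2 (hEn l hl)]
  constructor
  · rintro ⟨v, hv, hvE, hvψ⟩
    obtain ⟨hw, hwE⟩ := htransfer g hg hg' E v hv hvE
    refine ⟨_, hw, hwE, fun e he => ?_⟩
    obtain ⟨e, heψ, rfl⟩ := Finset.mem_image.1 he
    simp only [(hx _ (hmem e heψ).1).2, (hx _ (hmem e heψ).2).2]
    exact hvψ e heψ
  · rintro ⟨v, hv, hvE, hvψ⟩
    obtain ⟨hw, hwE⟩ := htransfer f hf hf' E v hv hvE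
    exact ⟨_, hw, hwE, fun e he => hvψ _ (Finset.mem_image_of_mem _ he)⟩

/-- There are few small sets over a ground set of moderate size. -/
lemma card_filter_card_le {α : Type*} (T : Finset α) {M : ℕ} (hM : 0 < M)
    (hT : T.card ≤ 36 * M ^ 2) :
    ((T.powerset.filter fun s => s.card ≤ M).card : ℝ) ≤ (100 * M : ℝ) ^ M := by
  have hM' : (0 : ℝ) < M := by exact_mod_cast hM
  set x : ℝ := 1 / (36 * M) with hx
  have hx0 : 0 < x := by positivity
  have hx1 : x ≤ 1 := by
    rw [hx, div_le_one (by positivity)]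
    have : (1 : ℝ) ≤ M := by exact_mod_cast hM
    linarith
  have h1 : ((T.powerset.filter fun s => s.card ≤ M).card : ℝ) * x ^ M ≤ (1 + x) ^ T.card := by
    calc ((T.powerset.filter fun s => s.card ≤ M).card : ℝ) * x ^ M
        = ∑ s ∈ T.powerset.filter (fun s => s.card ≤ M), x ^ M := by
          rw [Finset.sum_const, nsmul_eq_mul]
      _ ≤ ∑ s ∈ T.powerset.filter (fun s => s.card ≤ M), x ^ s.card :=
          Finset.sum_le_sum fun s hs =>
            pow_le_pow_of_le_one hx0.le hx1 (Finset.mem_filter.1 hs).2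
      _ ≤ ∑ s ∈ T.powerset, x ^ s.card :=
          Finset.sum_le_sum_of_subset_of_nonneg (Finset.filter_subset _ _)
            fun s _ _ => by positivity
      _ = (1 + x) ^ T.card := by
          rw [← Finset.prod_const, Finset.prod_one_add]
          exact Finset.sum_congr rfl fun s _ => (Finset.prod_const x).symm
  have h2 : (1 + x) ^ T.card ≤ Real.exp 1 ^ M := by
    calc (1 + x) ^ T.card ≤ (1 + x) ^ (36 * M ^ 2) :=
          pow_le_pow_right₀ (by linarith) hT
      _ ≤ Real.exp x ^ (36 * M ^ 2) := by
          gcongr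
          rw [add_comm]
          exact Real.add_one_le_exp x
      _ = Real.exp 1 ^ M := by
          rw [← Real.exp_nat_mul, ← Real.exp_nat_mul]
          congr 1
          rw [hx]
          push_cast
          field_simp
  have h3 : (100 * M : ℝ) ^ M * x ^ M ≥ Real.exp 1 ^ M := by
    rw [← mul_pow]
    have : 100 * (M : ℝ) * x = 100 / 36 := by
      rw [hx]
      field_simp
    rw [this]
    gcongr
    linarith [Real.exp_one_lt_d9]
  exact le_of_mul_le_mul_right (h1.trans (h2.trans h3)) (by positivity)

/-- The positive clauses containing the variable `0` and another variable below `n`. -/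
def starClauses (n : ℕ) : Formula :=
  ((Finset.range n).erase 0).image fun j => {(0, true), (j, true)}

/-- The clauses of size two over the variables `1, …, n - 1`. -/
def freeClauses (n : ℕ) : Formula :=
  (((Finset.range n).erase 0 ×ˢ (Finset.univ : Finset Bool)).powersetCard 2) \
    ((Finset.range n).erase 0).image fun v => {(v, true), (v, false)}

lemma card_of_mem_freeClauses {n : ℕ} {C : Clause} (h : C ∈ freeClauses n) : C.card = 2 :=
  (Finset.mem_powersetCard.1 (Finset.mem_sdiff.1 h).1).2

lemma fst_of_mem_freeClauses {n : ℕ} {C : Clause} (h : C ∈ freeClauses n) :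
    ∀ l ∈ C, l.1 ≠ 0 ∧ l.1 < n := by
  intro l hl
  simpa using (Finset.mem_powersetCard.1 (Finset.mem_sdiff.1 h).1).1 hl

lemma isClause_of_mem_freeClauses {n : ℕ} {C : Clause} (h : C ∈ freeClauses n) : IsClause C := by
  rintro v ⟨h1, h2⟩
  refine (Finset.mem_sdiff.1 h).2 (Finset.mem_image.2 ⟨v, ?_, ?_⟩)
  · simpa using fst_of_mem_freeClauses h _ h1
  · refine Finset.eq_of_subset_of_card_le ?_ ?_
    · simp [Finset.insert_subset_iff, h1, h2]
    · rw [card_of_mem_freeClauses h, Finset.card_pair (by simp)]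

lemma le_card_freeClauses {n : ℕ} (hn : 2 ≤ n) : 2 * (n - 1) * (n - 2) ≤ (freeClauses n).card := by
  obtain ⟨k, rfl⟩ := Nat.exists_eq_add_of_le' hn
  have hr : ((Finset.range (k + 2)).erase 0).card = k + 1 := by
    rw [Finset.card_erase_of_mem (by simp), Finset.card_range]
    rfl
  have h := Finset.le_card_sdiff
    (((Finset.range (k + 2)).erase 0).image fun v => ({(v, true), (v, false)} : Clause))
    (((Finset.range (k + 2)).erase 0 ×ˢ (Finset.univ : Finset Bool)).powersetCard 2)
  have h1 : (((Finset.range (k + 2)).erase 0).image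
      fun v => ({(v, true), (v, false)} : Clause)).card ≤ k + 1 := Finset.card_image_le.trans hr.le
  have h2 : (((Finset.range (k + 2)).erase 0 ×ˢ (Finset.univ : Finset Bool)).powersetCard 2).card
      = (k + 1) * (2 * k + 1) := by
    rw [Finset.card_powersetCard, Finset.card_product, hr, Finset.card_univ, Fintype.card_bool,
      Nat.choose_two_right]
    apply Nat.div_eq_of_eq_mul_left two_pos
    have : (k + 1) * 2 - 1 = 2 * k + 1 := by omega
    rw [this]
    ring
  have h3 : 2 * (k + 2 - 1) * (k + 2 - 2) + (k + 1) = (k + 1) * (2 * k + 1) := by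
    have h4 : k + 2 - 1 = k + 1 := rfl
    have h5 : k + 2 - 2 = k := rfl
    rw [h4, h5]
    ring
  rw [h2] at h
  change _ ≤ (freeClauses (k + 2)).card at h
  omega

lemma is2CNF_star_union {n : ℕ} {Q : Formula} (hQ : Q ⊆ freeClauses n) :
    Is2CNF (starClauses n ∪ Q) := by
  intro C hC
  rcases Finset.mem_union.1 hC with hC | hC
  · obtain ⟨j, hj, rfl⟩ := Finset.mem_image.1 hC
    refine ⟨fun v hv => ?_, Finset.card_pair fun h => ?_⟩
    · simpa using hv.2
    · exact (Finset.mem_erase.1 hj).1 (congrArg Prod.fst h).symm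
  · exact ⟨isClause_of_mem_freeClauses (hQ hC), card_of_mem_freeClauses (hQ hC)⟩

lemma Vars_star_union {n : ℕ} (hn : 2 ≤ n) {Q : Formula} (hQ : Q ⊆ freeClauses n) :
    Vars (starClauses n ∪ Q) = Finset.range n := by
  ext v
  rw [mem_Vars_iff, Finset.mem_range]
  constructor
  · rintro ⟨C, hC, l, hl, rfl⟩
    rcases Finset.mem_union.1 hC with hC | hC
    · obtain ⟨j, hj, rfl⟩ := Finset.mem_image.1 hC
      rcases Finset.mem_insert.1 hl with rfl | hl
      · exact two_pos.trans_le hn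
      · obtain rfl := Finset.mem_singleton.1 hl
        exact Finset.mem_range.1 (Finset.mem_erase.1 hj).2
    · exact (fst_of_mem_freeClauses (hQ hC) l hl).2
  · intro hv
    have hstar : ∀ j, j ≠ 0 → j < n → ({(0, true), (j, true)} : Clause) ∈ starClauses n ∪ Q :=
      fun j h0 hj => Finset.mem_union_left _ (Finset.mem_image.2 ⟨j, by simp [h0, hj], rfl⟩)
    rcases eq_or_ne v 0 with rfl | h0
    · exact ⟨_, hstar 1 one_ne_zero hn, (0, true), by simp, rfl⟩
    · exact ⟨_, hstar v h0 hv, (v, true), by simp, rfl⟩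

lemma mem_star_union_iff {n : ℕ} {Q : Formula} {E : Clause} (hE : E ∈ freeClauses n) :
    E ∈ starClauses n ∪ Q ↔ E ∈ Q := by
  rw [Finset.mem_union, or_iff_right]
  intro h
  obtain ⟨j, -, rfl⟩ := Finset.mem_image.1 h
  exact (fst_of_mem_freeClauses hE (0, true) (by simp)).1 rfl

/-- If BVA shortens all 2-CNF formulas with variables `0, …, n - 1` to at most `M` clauses, then
`M` satisfies the counting bound. -/
lemma two_pow_le_of_forall_exists_chain {n M : ℕ} (hn : 2 ≤ n) (hnM : n ≤ M)
    (h : ∀ φ : Formula, Is2CNF φ → Vars φ = Finset.range n →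
      ∃ φ', BVAChain φ φ' ∧ φ'.card ≤ M) :
    (2 : ℝ) ^ (2 * (n - 1) * (n - 2)) ≤ (100 * M : ℝ) ^ M := by
  classical
  have hcode : ∀ Q ∈ (freeClauses n).powerset,
      ∃ ψ ⊆ lits (n + 2 * M) ×ˢ lits (n + 2 * M), ψ.card ≤ M ∧
      ∀ E : Clause, E.card = 2 → (∀ l ∈ E, l.1 < n) →
        (E ∉ starClauses n ∪ Q ↔ ∃ v : Lit → Prop, ComplementaryOff (Finset.range n) v ∧
          FalseExactlyOn (Finset.range n) E v ∧ ∀ e ∈ ψ, v e.1 ∨ v e.2) := by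
    intro Q hQ
    rw [Finset.mem_powerset] at hQ
    have h2 := is2CNF_star_union hQ
    have hvars := Vars_star_union hn hQ
    obtain ⟨φ', hchain, hcard⟩ := h _ h2 hvars
    exact hchain.exists_compressed_pairs (fun E hE => (h2 E hE).2) hvars hcard
  choose! ψ hψT hψM hψ using hcode
  have hinj : Set.InjOn ψ (freeClauses n).powerset := by
    intro Q hQ Q' hQ' heq
    have hQs := Finset.mem_powerset.1 hQ
    have hQs' := Finset.mem_powerset.1 hQ'
    have hiff : ∀ E ∈ freeClauses n, E ∈ Q ↔ E ∈ Q' := by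
      intro E hE
      have h1 := hψ Q hQ E (card_of_mem_freeClauses hE) fun l hl =>
        (fst_of_mem_freeClauses hE l hl).2
      have h2 := hψ Q' hQ' E (card_of_mem_freeClauses hE) fun l hl =>
        (fst_of_mem_freeClauses hE l hl).2
      rw [heq, ← h2, mem_star_union_iff hE, mem_star_union_iff hE] at h1
      exact not_iff_not.1 h1
    ext E
    exact ⟨fun hE => (hiff E (hQs hE)).1 hE, fun hE => (hiff E (hQs' hE)).2 hE⟩
  have hcard := Finset.card_le_card_of_injOn
    (t := (lits (n + 2 * M) ×ˢ lits (n + 2 * M)).powerset.filter fun s => s.card ≤ M) ψ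
    (fun Q hQ => Finset.mem_filter.2 ⟨Finset.mem_powerset.2 (hψT Q hQ), hψM Q hQ⟩) hinj
  rw [Finset.card_powerset] at hcard
  have hT : (lits (n + 2 * M) ×ˢ lits (n + 2 * M)).card ≤ 36 * M ^ 2 := by
    rw [Finset.card_product, card_lits]
    nlinarith
  calc (2 : ℝ) ^ (2 * (n - 1) * (n - 2)) ≤ 2 ^ (freeClauses n).card :=
        pow_le_pow_right₀ one_le_two (le_card_freeClauses hn)
    _ ≤ _ := by exact_mod_cast hcard
    _ ≤ (100 * M : ℝ) ^ M := card_filter_card_le _ (by omega) hT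

/-- idealized BVA lower bound for arbitrary 2-CNF formulas. -/
theorem bva_general_lower (ε : ℝ) (hε : 0 < ε) :
    ∃ N : ℕ, ∀ n : ℕ, N ≤ n →
      ∃ φ : Formula, Is2CNF φ ∧ (Vars φ).card = n ∧
        ∀ φ' : Formula, BVAChain φ φ' →
          (1 - ε) * (n : ℝ) ^ 2 / Real.logb 2 (n : ℝ) ≤ (φ'.card : ℝ) := by
  wlog hε' : ε ≤ 1 / 2 generalizing ε
  · obtain ⟨N, hN⟩ := this (1 / 2) (by norm_num) le_rfl
    refine ⟨max N 1, fun n hn => ?_⟩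
    obtain ⟨φ, h2, hv, hφ⟩ := hN n (le_trans (le_max_left _ _) hn)
    refine ⟨φ, h2, hv, fun φ' h => le_trans ?_ (hφ φ' h)⟩
    have hn1 : (1 : ℝ) ≤ n := by exact_mod_cast le_trans (le_max_right _ _) hn
    have := Real.logb_nonneg one_lt_two hn1
    gcongr
    linarith
  obtain ⟨N₀, hN₀⟩ : ∃ N₀ : ℕ, ∀ n : ℕ, N₀ ≤ n →
      100 ≤ Real.logb 2 n ∧ 4 * Real.logb 2 n ≤ n := by
    have h1 : ∀ᶠ x : ℝ in Filter.atTop, 100 ≤ Real.logb 2 x :=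
      (Real.tendsto_logb_atTop one_lt_two).eventually_ge_atTop 100
    have h2 : ∀ᶠ x : ℝ in Filter.atTop, 4 * Real.logb 2 x ≤ x := by
      have hlog : 0 < Real.log 2 := Real.log_pos one_lt_two
      filter_upwards [Real.isLittleO_log_id_atTop.bound (c := Real.log 2 / 4) (by positivity),
        Filter.eventually_ge_atTop (1 : ℝ)] with x hx hx1
      rw [id, Real.norm_of_nonneg (Real.log_nonneg hx1), Real.norm_of_nonneg (by linarith)] at hx
      rw [Real.logb, ← mul_div_assoc, div_le_iff₀ hlog]
      linarith
    exact Filter.eventually_atTop.1 (tendsto_natCast_atTop_atTop.eventually (h1.and h2))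
  refine ⟨max (max N₀ 4) ⌈3 / ε⌉₊, fun n hn => ?_⟩
  obtain ⟨hlog, hlogn⟩ := hN₀ n (le_trans (le_max_left _ _) (le_trans (le_max_left _ _) hn))
  have hn4 : 4 ≤ n := le_trans (le_max_right _ _) (le_trans (le_max_left _ _) hn)
  have hnε : 3 ≤ n * ε := by
    rw [← div_le_iff₀ hε]
    exact (Nat.le_ceil _).trans (by exact_mod_cast le_trans (le_max_right _ _) hn)
  have hn4' : (4 : ℝ) ≤ n := by exact_mod_cast hn4
  set L := Real.logb 2 n with hL
  have hL0 : 0 < L := by linarith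
  set B : ℝ := (1 - ε) * (n : ℝ) ^ 2 / L with hB
  by_contra! hcon
  have hBL : B * L = (1 - ε) * (n : ℝ) ^ 2 := div_mul_cancel₀ _ hL0.ne'
  have hB0 : 0 ≤ B := by
    have : 0 ≤ 1 - ε := by linarith
    positivity
  have hnB : (n : ℝ) ≤ B := by
    rw [hB, le_div_iff₀ hL0]
    nlinarith
  have hnM : n ≤ ⌊B⌋₊ := Nat.le_floor hnB
  have hMB : (⌊B⌋₊ : ℝ) ≤ B := Nat.floor_le hB0
  have hcount := two_pow_le_of_forall_exists_chain (by omega) hnM fun φ h2 hv => by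
    obtain ⟨φ', hchain, hcard⟩ := hcon φ h2 (by rw [hv, Finset.card_range])
    exact ⟨φ', hchain, Nat.le_floor hcard.le⟩
  have hM100 : 100 * (⌊B⌋₊ : ℝ) ≤ (2 : ℝ) ^ (2 * L) := by
    have hn0 : (0 : ℝ) < n := by linarith
    rw [mul_comm 2 L, Real.rpow_mul zero_le_two, hL,
      Real.rpow_logb two_pos (by norm_num) hn0, Real.rpow_two]
    nlinarith
  have hupper : (100 * (⌊B⌋₊ : ℝ)) ^ ⌊B⌋₊ ≤ (2 : ℝ) ^ (2 * L * ⌊B⌋₊) := by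
    rw [Real.rpow_mul zero_le_two, Real.rpow_natCast]
    gcongr
  have hexp := hcount.trans hupper
  rw [← Real.rpow_natCast, Real.rpow_le_rpow_left_iff one_lt_two] at hexp
  push_cast [Nat.cast_sub (by omega : 1 ≤ n), Nat.cast_sub (by omega : 2 ≤ n)] at hexp
  nlinarith

end BVAPaper
end

section
/- Let n ≥ 4, let R be a strict polarized rectifier network realizing K_n with m edges, and let x be a base vertex of R whose total degree is at least 3. Then there exists a strict polarized rectifier network realizing K_{n−1} with at most m − 3 edges. -/
namespace BVAPaper

theorem ValidWalk.mem {R : PRN} {u v : ℕ} {π : List ℕ} (h : ValidWalk R u v π) :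
    ∀ a ∈ π, a = u ∨ a = v ∨ a ∈ R.aux := by
  obtain ⟨h2, hu, hv, -, -, -, hi⟩ := h
  intro a ha
  obtain ⟨i, hil, rfl⟩ := List.mem_iff_getElem.1 ha
  rcases Nat.eq_zero_or_pos i with rfl | hpos
  · left
    rw [List.head?_eq_getElem?, List.getElem?_eq_getElem hil] at hu
    exact Option.some.inj hu
  · by_cases hlast : i + 1 < π.length
    · right; right
      simpa [List.getD_eq_getElem?_getD, List.getElem?_eq_getElem hil] using hi i hpos hlast
    · right; left
      have hi' : π.length - 1 = i := by omega
      rw [List.getLast?_eq_getElem?, hi', List.getElem?_eq_getElem hil] at hv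
      exact Option.some.inj hv

open Classical in
/-- Delete the base vertex `x`, together with all auxiliary vertices that lie on no valid walk
between the remaining base vertices. -/
noncomputable def PRN.deleteBase (R : PRN) (x : ℕ) : PRN where
  base := R.base.erase x
  aux := R.aux.filter fun a => ∃ u v π, ValidWalk R u v π ∧ u ≠ x ∧ v ≠ x ∧ a ∈ π
  edges := R.edges.filter fun e =>
    ∀ w, w = e.1 ∨ w = e.2 → w ∈ R.base.erase x ∨
      w ∈ R.aux ∧ ∃ u v π, ValidWalk R u v π ∧ u ≠ x ∧ v ≠ x ∧ w ∈ π
  pol := R.pol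

theorem PRN.mem_aux_deleteBase {R : PRN} {x a : ℕ} : a ∈ (R.deleteBase x).aux ↔
    a ∈ R.aux ∧ ∃ u v π, ValidWalk R u v π ∧ u ≠ x ∧ v ≠ x ∧ a ∈ π := by
  simp only [PRN.deleteBase, Finset.mem_filter]

theorem PRN.mem_edges_deleteBase {R : PRN} {x : ℕ} {e : ℕ × ℕ} :
    e ∈ (R.deleteBase x).edges ↔ e ∈ R.edges ∧
      ∀ w, w = e.1 ∨ w = e.2 → w ∈ R.base.erase x ∨
        w ∈ R.aux ∧ ∃ u v π, ValidWalk R u v π ∧ u ≠ x ∧ v ≠ x ∧ w ∈ π := by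
  simp only [PRN.deleteBase, Finset.mem_filter]

theorem validWalk_deleteBase {R : PRN} {x u v : ℕ} {π : List ℕ} :
    ValidWalk (R.deleteBase x) u v π ↔ ValidWalk R u v π ∧ u ≠ x ∧ v ≠ x := by
  constructor
  · rintro ⟨h2, hu, hv, hub, hvb, hc, hi⟩
    simp only [PRN.deleteBase, Finset.mem_erase] at hub hvb
    refine ⟨⟨h2, hu, hv, hub.2, hvb.2, ?_, ?_⟩, hub.1, hvb.1⟩
    · exact hc.imp fun a b hab => (PRN.mem_edges_deleteBase.1 hab).1
    · exact fun i h0 h1 => (PRN.mem_aux_deleteBase.1 (hi i h0 h1)).1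
  · rintro ⟨h, hux, hvx⟩
    have hmem := h.mem
    obtain ⟨h2, hu, hv, hub, hvb, hc, hi⟩ := id h
    refine ⟨h2, hu, hv, Finset.mem_erase.2 ⟨hux, hub⟩, Finset.mem_erase.2 ⟨hvx, hvb⟩, ?_, ?_⟩
    · have key : ∀ w ∈ π, w ∈ R.base.erase x ∨
          w ∈ R.aux ∧ ∃ u v π, ValidWalk R u v π ∧ u ≠ x ∧ v ≠ x ∧ w ∈ π := by
        intro w hw
        rcases hmem w hw with rfl | rfl | hw'
        · exact Or.inl (Finset.mem_erase.2 ⟨hux, hub⟩)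
        · exact Or.inl (Finset.mem_erase.2 ⟨hvx, hvb⟩)
        · exact Or.inr ⟨hw', u, v, π, h, hux, hvx, hw⟩
      refine List.isChain_iff_getElem.2 ?_
      replace hc := List.isChain_iff_getElem.1 hc
      intro i hi
      refine PRN.mem_edges_deleteBase.2 ⟨hc i hi, ?_⟩
      rintro w (rfl | rfl)
      · exact key _ (List.getElem_mem _)
      · exact key _ (List.getElem_mem _)
    · intro i h0 h1
      refine PRN.mem_aux_deleteBase.2 ⟨hi i h0 h1, u, v, π, h, hux, hvx, ?_⟩
      have : i < π.length := by omega
      simp [List.getD_eq_getElem?_getD, List.getElem?_eq_getElem this]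

theorem PRN.WF.deleteBase {R : PRN} (h : R.WF) (x : ℕ) : (R.deleteBase x).WF := by
  classical
  refine ⟨Finset.disjoint_of_subset_left (Finset.erase_subset _ _)
    (Finset.disjoint_of_subset_right (Finset.filter_subset _ _) h.1), ?_⟩
  intro e he
  obtain ⟨he, hw⟩ := PRN.mem_edges_deleteBase.1 he
  refine ⟨?_, ?_, (h.2 e he).2.2⟩
  · simpa [PRN.deleteBase] using hw e.1 (Or.inl rfl)
  · simpa [PRN.deleteBase] using hw e.2 (Or.inr rfl)

theorem IsSPRN.deleteBase {R : PRN} (h : IsSPRN R) (x : ℕ) : IsSPRN (R.deleteBase x) := by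
  refine ⟨?_, ?_⟩
  · intro u hu v hv huv π₁ π₂ h₁ h₂
    simp only [validWalk_deleteBase] at h₁ h₂
    exact h.1 u (Finset.mem_of_mem_erase hu) v (Finset.mem_of_mem_erase hv) huv π₁ π₂
      (h₁.imp And.left And.left) (h₂.imp And.left And.left)
  · intro a ha
    obtain ⟨-, u, v, π, hπ, hu, hv, haπ⟩ := PRN.mem_aux_deleteBase.1 ha
    exact ⟨u, v, π, validWalk_deleteBase.2 ⟨hπ, hu, hv⟩, haπ⟩

theorem card_edges_deleteBase_add_totalDeg_le {R : PRN} (h : R.WF) {x : ℕ} (hx : x ∈ R.base) :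
    (R.deleteBase x).edges.card + totalDeg R x ≤ R.edges.card := by
  have hxaux : x ∉ R.aux := Finset.disjoint_left.1 h.1 hx
  have hdel : ∀ e ∈ (R.deleteBase x).edges, e ∈ R.edges ∧ e.1 ≠ x ∧ e.2 ≠ x := by
    intro e he
    obtain ⟨he, hw⟩ := PRN.mem_edges_deleteBase.1 he
    refine ⟨he, ?_, ?_⟩
    · intro hex
      have := hw x (Or.inl hex.symm)
      simp [hxaux] at this
    · intro hex
      have := hw x (Or.inr hex.symm)
      simp [hxaux] at this
  rw [totalDeg, ← Finset.card_union_of_disjoint, ← Finset.card_union_of_disjoint]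
  · refine Finset.card_le_card fun e he => ?_
    simp only [Finset.mem_union, Finset.mem_filter] at he
    rcases he with he | he | he
    exacts [(hdel e he).1, he.1, he.1]
  · refine Finset.disjoint_left.2 fun e he he' => ?_
    simp only [Finset.mem_union, Finset.mem_filter] at he'
    rcases he' with he' | he'
    exacts [(hdel e he).2.1 he'.2, (hdel e he).2.2 he'.2]
  · refine Finset.disjoint_left.2 fun e he he' => ?_
    rw [Finset.mem_filter] at he he'
    exact (h.2 e he.1).2.2 (he.2.trans he'.2.symm)

/-- Rename the vertices of a PRN along a permutation of the labels. -/
def PRN.relabel (R : PRN) (σ : Equiv.Perm ℕ) : PRN where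
  base := R.base.map σ.toEmbedding
  aux := R.aux.map σ.toEmbedding
  edges := R.edges.map (σ.prodCongr σ).toEmbedding
  pol e := R.pol (σ.symm e.1, σ.symm e.2)

theorem PRN.mem_edges_relabel {R : PRN} {σ : Equiv.Perm ℕ} {e : ℕ × ℕ} :
    e ∈ (R.relabel σ).edges ↔ (σ.symm e.1, σ.symm e.2) ∈ R.edges := by
  simp only [PRN.relabel, Finset.mem_map_equiv]
  rfl

theorem validWalk_relabel {R : PRN} {σ : Equiv.Perm ℕ} {u v : ℕ} {π : List ℕ} :
    ValidWalk (R.relabel σ) u v π ↔ ValidWalk R (σ.symm u) (σ.symm v) (π.map σ.symm) := by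
  have haux : (∀ i : ℕ, 0 < i → i + 1 < π.length → π.getD i 0 ∈ (R.relabel σ).aux) ↔
      ∀ i : ℕ, 0 < i → i + 1 < π.length → (π.map σ.symm).getD i 0 ∈ R.aux := by
    refine forall_congr' fun i => forall_congr' fun _ => forall_congr' fun h => ?_
    have hi : i < π.length := by omega
    simp [PRN.relabel, Finset.mem_map_equiv, List.getD_eq_getElem?_getD,
      List.getElem?_eq_getElem hi]
  have hchain : List.IsChain (fun a b => (a, b) ∈ (R.relabel σ).edges) π ↔
      List.IsChain (fun a b => (a, b) ∈ R.edges) (π.map σ.symm) := by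
    simp only [PRN.mem_edges_relabel]
    exact (List.isChain_map (R := fun a b => (a, b) ∈ R.edges) σ.symm).symm
  have hhead : π.head? = some u ↔ (π.map σ.symm).head? = some (σ.symm u) := by
    simp [List.head?_map]
  have hlast : π.getLast? = some v ↔ (π.map σ.symm).getLast? = some (σ.symm v) := by
    simp [List.getLast?_map]
  have hbase : ∀ w, w ∈ (R.relabel σ).base ↔ σ.symm w ∈ R.base := fun w => by
    rw [PRN.relabel, Finset.mem_map_equiv]
  simp only [ValidWalk, haux, hhead, hlast, hbase, List.length_map]
  exact and_congr_right fun _ => and_congr_right fun _ => and_congr_right fun _ =>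
    and_congr_right fun _ => and_congr_right fun _ => and_congr_left fun _ => hchain

theorem walkPol_relabel {R : PRN} {σ : Equiv.Perm ℕ} {π : List ℕ} (h : 2 ≤ π.length) :
    walkPol (R.relabel σ) π = walkPol R (π.map σ.symm) := by
  have h₁ : π.length - 1 < π.length := by omega
  have h₂ : π.length - 2 < π.length := by omega
  simp [walkPol, PRN.relabel, List.getD_eq_getElem?_getD, List.getElem?_eq_getElem h₁,
    List.getElem?_eq_getElem h₂]

theorem PRN.WF.relabel {R : PRN} (h : R.WF) (σ : Equiv.Perm ℕ) : (R.relabel σ).WF := by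
  refine ⟨(Finset.disjoint_map _).2 h.1, fun e he => ?_⟩
  have := h.2 _ (PRN.mem_edges_relabel.1 he)
  simpa [PRN.relabel, Finset.mem_union, Finset.mem_map_equiv] using this

theorem IsSPRN.relabel {R : PRN} (h : IsSPRN R) (σ : Equiv.Perm ℕ) : IsSPRN (R.relabel σ) := by
  refine ⟨?_, ?_⟩
  · intro u hu v hv huv π₁ π₂ h₁ h₂
    rw [PRN.relabel, Finset.mem_map_equiv] at hu hv
    simp only [validWalk_relabel] at h₁ h₂
    exact List.map_injective_iff.2 σ.symm.injective
      (h.1 _ hu _ hv (σ.symm.injective.ne huv) _ _ h₁ h₂)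
  · intro a ha
    rw [PRN.relabel, Finset.mem_map_equiv] at ha
    obtain ⟨u, v, π, hπ, haπ⟩ := h.2 _ ha
    refine ⟨σ u, σ v, π.map σ, validWalk_relabel.2 ?_, ?_⟩
    · simpa [List.map_map] using hπ
    · simpa using List.mem_map_of_mem (f := σ) haπ

theorem RealizesDiagram.relabel_deleteBase {R : PRN} {n x : ℕ}
    (hR : RealizesDiagram R (completeDiagram n)) (hx : x ∈ R.base) :
    RealizesDiagram ((R.deleteBase x).relabel (Equiv.swap x (n - 1)))
      (completeDiagram (n - 1)) := by
  obtain ⟨P, ⟨hV, hdir, hundir, hanti⟩, hbase, hwalk⟩ := hR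
  have hxn : x < n := by
    rw [hbase, hV] at hx
    simpa [completeDiagram] using hx
  set σ : Equiv.Perm ℕ := Equiv.swap x (n - 1) with hσ
  have hlt : ∀ u, u < n - 1 ↔ σ.symm u < n ∧ σ.symm u ≠ x := by
    intro u
    rw [hσ, Equiv.symm_swap, Equiv.swap_apply_def]
    split_ifs <;> omega
  let P' : PolDiagram :=
    ⟨Finset.range (n - 1),
      (P.edges.filter fun e => e.1 ≠ x ∧ e.2 ≠ x).map (σ.prodCongr σ).toEmbedding,
      fun e => P.pol (σ.symm e.1, σ.symm e.2)⟩
  have hmem : ∀ u v, (u, v) ∈ P'.edges ↔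
      (σ.symm u, σ.symm v) ∈ P.edges ∧ σ.symm u ≠ x ∧ σ.symm v ≠ x := by
    intro u v
    simp only [P', Finset.mem_map_equiv]
    exact Finset.mem_filter
  have hpol : ∀ u v, P'.pol (u, v) = P.pol (σ.symm u, σ.symm v) := fun _ _ => rfl
  refine ⟨P', ⟨rfl, ?_, ?_, ?_⟩, ?_, ?_⟩
  · intro u v
    have := hdir (σ.symm u) (σ.symm v)
    simp only [completeDiagram, Finset.notMem_empty, false_iff] at this ⊢
    rw [hmem, hpol]
    tauto
  · intro u v
    have := hundir (σ.symm u) (σ.symm v)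
    simp only [completeDiagram, Finset.mem_filter, Finset.mem_product, Finset.mem_range, ne_eq,
      EmbeddingLike.apply_eq_iff_eq] at this ⊢
    rw [hlt u, hlt v, hmem, hmem, hpol, hpol]
    tauto
  · intro u v
    rw [hmem, hmem]
    exact fun h => hanti _ _ ⟨h.1.1, h.2.1⟩
  · ext u
    rw [PRN.relabel, Finset.mem_map_equiv, PRN.deleteBase, Finset.mem_erase, hbase, hV]
    simp only [completeDiagram, P', Finset.mem_range, hlt u]
    tauto
  · intro u hu v hv
    have hu' := (hlt u).1 (Finset.mem_range.1 hu)
    have hv' := (hlt v).1 (Finset.mem_range.1 hv)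
    have hverts : ∀ w, w < n → w ∈ P.verts := fun w hw => by
      rw [hV]; exact Finset.mem_range.2 hw
    rw [hmem, hpol, hwalk _ (hverts _ hu'.1) _ (hverts _ hv'.1)]
    simp only [validWalk_relabel, validWalk_deleteBase]
    constructor
    · rintro ⟨⟨π, hπ, hp⟩, hux, hvx⟩
      have hmap : (π.map σ).map σ.symm = π := by simp [List.map_map]
      refine ⟨π.map σ, ⟨by rwa [hmap], hux, hvx⟩, ?_⟩
      rw [walkPol_relabel (by simpa using hπ.1), hmap]
      exact hp
    · rintro ⟨π, ⟨hπ, hux, hvx⟩, hp⟩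
      refine ⟨⟨π.map σ.symm, hπ, ?_⟩, hux, hvx⟩
      rw [walkPol_relabel (by simpa using hπ.1)] at hp
      exact hp

/-- deleting a base vertex of total degree at least 3. -/
theorem deg_three_lemma (n : ℕ) (hn : 4 ≤ n) (R : PRN) (hWF : R.WF)
    (hS : IsSPRN R) (hreal : RealizesDiagram R (completeDiagram n))
    (m : ℕ) (hm : R.edges.card = m)
    (x : ℕ) (hx : x ∈ R.base) (hdeg : 3 ≤ totalDeg R x) :
    ∃ R' : PRN, R'.WF ∧ IsSPRN R' ∧ RealizesDiagram R' (completeDiagram (n - 1)) ∧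
      R'.edges.card ≤ m - 3 := by
  refine ⟨(R.deleteBase x).relabel (Equiv.swap x (n - 1)), (hWF.deleteBase x).relabel _,
    (hS.deleteBase x).relabel _, hreal.relabel_deleteBase hx, ?_⟩
  have := card_edges_deleteBase_add_totalDeg_le hWF hx
  rw [PRN.relabel, Finset.card_map]
  omega

end BVAPaper
end
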